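/- arXiv:2601.19284 — 3 statements merged into one kernel-verified Lean document; each statement's English description precedes it below -/
import Mathlib

section
/- Let γ ∈ (0,1] and K ∈ S_γ. Then the discounted cost function J_γ (defined on the open set S_γ, e.g. as the everywhere-defined sum K' ↦ Σ_{t=0}^∞ γ^t Tr(((A−BK'C)ᵀ)^t (Q + C ᵀK'ᵀRK'C)(A−BK'C)^t)) is Fréchet differentiable at K, and its gradient with respect to the Frobenius inner product equals 2E_KΣ_K(γ)Cᵀ; that is, for every direction H ∈ ℝ^{m×p} the derivative of J_γ at K in direction H equals Tr((2E_KΣ_K(γ)Cᵀ)ᵀ H). -/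
open Matrix

noncomputable section

/-- Spectral radius of a real square matrix: the largest modulus of a complex eigenvalue. -/
def specRad {n : ℕ} (M : Matrix (Fin n) (Fin n) ℝ) : ℝ :=
  sSup {r : ℝ | ∃ μ ∈ spectrum ℂ (M.map (algebraMap ℝ ℂ)), r = ‖μ‖}

/-- Spectral (ℓ²→ℓ² operator) norm of a real matrix. -/
def spNorm {a b : ℕ} (M : Matrix (Fin a) (Fin b) ℝ) : ℝ :=
  ‖LinearMap.toContinuousLinearMap (Matrix.toEuclideanLin M)‖

/-- Frobenius norm of a real matrix. -/
def frobNorm {a b : ℕ} (M : Matrix (Fin a) (Fin b) ℝ) : ℝ :=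
  Real.sqrt (∑ i, ∑ j, (M i j) ^ 2)

/-- Euclidean norm of a vector. -/
def vecNorm {a : ℕ} (x : Fin a → ℝ) : ℝ :=
  Real.sqrt (∑ i, (x i) ^ 2)

variable {n m p : ℕ}

/-- Closed-loop matrix `A - BKC`. -/
def Acl (A : Matrix (Fin n) (Fin n) ℝ) (B : Matrix (Fin n) (Fin m) ℝ)
    (C : Matrix (Fin p) (Fin n) ℝ) (K : Matrix (Fin m) (Fin p) ℝ) : Matrix (Fin n) (Fin n) ℝ :=
  A - B * K * C

/-- Membership in the stabilizing set `S_γ`: `√γ · ρ(A − BKC) < 1`. -/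
def inS (A : Matrix (Fin n) (Fin n) ℝ) (B : Matrix (Fin n) (Fin m) ℝ)
    (C : Matrix (Fin p) (Fin n) ℝ) (γ : ℝ) (K : Matrix (Fin m) (Fin p) ℝ) : Prop :=
  Real.sqrt γ * specRad (Acl A B C K) < 1

/-- The solution `P_K(γ) = Σ_{t} γ^t ((A−BKC)ᵀ)^t (Q + CᵀKᵀRKC) (A−BKC)^t` of the
discounted Lyapunov equation. -/
def Pmat (A : Matrix (Fin n) (Fin n) ℝ) (B : Matrix (Fin n) (Fin m) ℝ)
    (C : Matrix (Fin p) (Fin n) ℝ) (Q : Matrix (Fin n) (Fin n) ℝ) (R : Matrix (Fin m) (Fin m) ℝ)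
    (γ : ℝ) (K : Matrix (Fin m) (Fin p) ℝ) : Matrix (Fin n) (Fin n) ℝ :=
  ∑' t : ℕ, γ ^ t • ((Acl A B C K)ᵀ ^ t * (Q + Cᵀ * Kᵀ * R * K * C) * (Acl A B C K) ^ t)

/-- The Gramian `Σ_K(γ) = Σ_{t} γ^t (A−BKC)^t ((A−BKC)ᵀ)^t`. -/
def Smat (A : Matrix (Fin n) (Fin n) ℝ) (B : Matrix (Fin n) (Fin m) ℝ)
    (C : Matrix (Fin p) (Fin n) ℝ) (γ : ℝ) (K : Matrix (Fin m) (Fin p) ℝ) :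
    Matrix (Fin n) (Fin n) ℝ :=
  ∑' t : ℕ, γ ^ t • ((Acl A B C K) ^ t * ((Acl A B C K)ᵀ) ^ t)

/-- The discounted cost `J_γ(K) = Tr(P_K(γ))`. -/
def Jcost (A : Matrix (Fin n) (Fin n) ℝ) (B : Matrix (Fin n) (Fin m) ℝ)
    (C : Matrix (Fin p) (Fin n) ℝ) (Q : Matrix (Fin n) (Fin n) ℝ) (R : Matrix (Fin m) (Fin m) ℝ)
    (γ : ℝ) (K : Matrix (Fin m) (Fin p) ℝ) : ℝ :=
  (Pmat A B C Q R γ K).trace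

/-- `E_K = (R + γBᵀP_K(γ)B)KC − γBᵀP_K(γ)A`. -/
def Egrad (A : Matrix (Fin n) (Fin n) ℝ) (B : Matrix (Fin n) (Fin m) ℝ)
    (C : Matrix (Fin p) (Fin n) ℝ) (Q : Matrix (Fin n) (Fin n) ℝ) (R : Matrix (Fin m) (Fin m) ℝ)
    (γ : ℝ) (K : Matrix (Fin m) (Fin p) ℝ) : Matrix (Fin m) (Fin n) ℝ :=
  (R + γ • (Bᵀ * Pmat A B C Q R γ K * B)) * K * C - γ • (Bᵀ * Pmat A B C Q R γ K * A)

/-- The closed-form gradient `∇J_γ(K) = 2 E_K Σ_K(γ) Cᵀ`. -/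
def gradJ (A : Matrix (Fin n) (Fin n) ℝ) (B : Matrix (Fin n) (Fin m) ℝ)
    (C : Matrix (Fin p) (Fin n) ℝ) (Q : Matrix (Fin n) (Fin n) ℝ) (R : Matrix (Fin m) (Fin m) ℝ)
    (γ : ℝ) (K : Matrix (Fin m) (Fin p) ℝ) : Matrix (Fin m) (Fin p) ℝ :=
  (2 : ℝ) • (Egrad A B C Q R γ K * Smat A B C γ K * Cᵀ)

end

attribute [local instance] Matrix.frobeniusSeminormedAddCommGroup
  Matrix.frobeniusNormedAddCommGroup Matrix.frobeniusNormedSpace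

section StableMatrices

attribute [local instance] Matrix.frobeniusNormedRing Matrix.frobeniusNormedAlgebra

open Filter Topology Asymptotics

/-- Gelfand's formula for real matrices: some power of `M` has norm below `s ^ N` as soon as
`s` exceeds the spectral radius. -/
lemma exists_norm_pow_lt_of_specRad_lt {n : ℕ} (M : Matrix (Fin n) (Fin n) ℝ) {s : ℝ}
    (hs : specRad M < s) : ∃ N : ℕ, 1 ≤ N ∧ ‖M ^ N‖ < s ^ N := by
  have hρ : 0 ≤ specRad M := Real.sSup_nonneg (by rintro _ ⟨μ, -, rfl⟩; exact norm_nonneg μ)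
  set Mc : Matrix (Fin n) (Fin n) ℂ := M.map (algebraMap ℝ ℂ) with hMc
  have hbdd : BddAbove {r : ℝ | ∃ μ ∈ spectrum ℂ Mc, r = ‖μ‖} := by
    refine ⟨‖Mc‖ * ‖(1 : Matrix (Fin n) (Fin n) ℂ)‖, ?_⟩
    rintro _ ⟨μ, hμ, rfl⟩
    exact spectrum.norm_le_norm_mul_of_mem hμ
  have hle : spectralRadius ℂ Mc ≤ ENNReal.ofReal (specRad M) := by
    refine iSup₂_le fun μ hμ => ?_
    rw [← ENNReal.ofReal_coe_nnreal]
    exact ENNReal.ofReal_le_ofReal (le_csSup hbdd ⟨μ, hμ, rfl⟩)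
  have hlt : spectralRadius ℂ Mc < ENNReal.ofReal s :=
    hle.trans_lt ((ENNReal.ofReal_lt_ofReal_iff (hρ.trans_lt hs)).2 hs)
  have hev := (spectrum.pow_nnnorm_pow_one_div_tendsto_nhds_spectralRadius Mc).eventually
    (gt_mem_nhds hlt)
  obtain ⟨N, hN, hN1⟩ := (hev.and (eventually_ge_atTop 1)).exists
  refine ⟨N, hN1, ?_⟩
  have hN0 : (N : ℝ) ≠ 0 := by positivity
  have hpow := ENNReal.rpow_lt_rpow hN (z := (N : ℝ)) (by positivity)
  rw [← ENNReal.rpow_mul, one_div_mul_cancel hN0, ENNReal.rpow_one, ENNReal.rpow_natCast,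
    ← ENNReal.ofReal_pow (hρ.trans hs.le), ← ENNReal.ofReal_coe_nnreal,
    ENNReal.ofReal_lt_ofReal_iff (pow_pos (hρ.trans_lt hs) N)] at hpow
  have hmap : Mc ^ N = (M ^ N).map (algebraMap ℝ ℂ) :=
    (map_pow (algebraMap ℝ ℂ).mapMatrix M N).symm
  have hnorm : ‖Mc ^ N‖ = ‖M ^ N‖ := by
    rw [hmap]
    exact Matrix.frobenius_norm_map_eq _ _ fun x => Complex.norm_real x
  rwa [coe_nnnorm, hnorm] at hpow

/-- A geometric bound on the powers of `a` that is uniform in a neighbourhood of `a`. -/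
lemma exists_eventually_norm_pow_le {R : Type*} [NormedRing R] (a : R) {s : ℝ} (hs : 0 < s)
    {N : ℕ} (hN : 1 ≤ N) (ha : ‖a ^ N‖ < s ^ N) :
    ∃ D : ℝ, ∀ᶠ x in 𝓝 a, ∀ t : ℕ, ‖x ^ t‖ ≤ D * s ^ t := by
  refine ⟨∑ j ∈ Finset.range N, (‖a ^ j‖ + 1) / s ^ j, ?_⟩
  have hcont : ∀ j : ℕ, Continuous fun x : R => ‖x ^ j‖ := fun j => by fun_prop
  have hsmall : ∀ᶠ x in 𝓝 a, ∀ j ∈ Finset.range N, ‖x ^ j‖ < ‖a ^ j‖ + 1 :=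
    (Filter.eventually_all_finset _).2 fun j _ =>
      (hcont j).continuousAt.eventually (gt_mem_nhds (lt_add_one _))
  filter_upwards [hsmall, (hcont N).continuousAt.eventually (gt_mem_nhds ha)] with x hx hxN t
  induction t using Nat.strong_induction_on with
  | _ t ih =>
    rcases lt_or_ge t N with ht | ht
    · rw [← div_le_iff₀ (pow_pos hs t)]
      calc ‖x ^ t‖ / s ^ t ≤ (‖a ^ t‖ + 1) / s ^ t := by
            gcongr; exact (hx t (Finset.mem_range.2 ht)).le
        _ ≤ _ := Finset.single_le_sum (f := fun j => (‖a ^ j‖ + 1) / s ^ j)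
            (fun j _ => by positivity) (Finset.mem_range.2 ht)
    · obtain ⟨k, rfl⟩ := Nat.exists_eq_add_of_le ht
      have hk := ih k (by omega)
      calc ‖x ^ (N + k)‖ ≤ ‖x ^ N‖ * ‖x ^ k‖ := by rw [pow_add]; exact norm_mul_le _ _
        _ ≤ s ^ N * ((∑ j ∈ Finset.range N, (‖a ^ j‖ + 1) / s ^ j) * s ^ k) := by gcongr
        _ = _ := by ring

section GeometricBound

variable {n : ℕ} {M : Matrix (Fin n) (Fin n) ℝ} {γ s D : ℝ}

lemma norm_smul_pow_mul_transpose_pow_le (hγ : 0 ≤ γ) (hM : ∀ t : ℕ, ‖M ^ t‖ ≤ D * s ^ t)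
    (t : ℕ) : ‖γ ^ t • (M ^ t * Mᵀ ^ t)‖ ≤ D ^ 2 * (γ * s ^ 2) ^ t := by
  have hT : ‖Mᵀ ^ t‖ = ‖M ^ t‖ := by rw [← transpose_pow, frobenius_norm_transpose]
  calc ‖γ ^ t • (M ^ t * Mᵀ ^ t)‖ ≤ γ ^ t * (‖M ^ t‖ * ‖Mᵀ ^ t‖) := by
        rw [norm_smul, Real.norm_of_nonneg (pow_nonneg hγ t)]
        gcongr
        exact norm_mul_le _ _
    _ ≤ γ ^ t * ((D * s ^ t) * (D * s ^ t)) := by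
        rw [hT]
        gcongr
        · exact (norm_nonneg _).trans (hM t)
        · exact hM t
        · exact hM t
    _ = _ := by ring

lemma summable_geometric_bound (hγ : 0 ≤ γ) (hγs : γ * s ^ 2 < 1) :
    Summable fun t : ℕ => D ^ 2 * (γ * s ^ 2) ^ t :=
  (summable_geometric_of_lt_one (by positivity) hγs).mul_left _

lemma summable_gramian (hγ : 0 ≤ γ) (hγs : γ * s ^ 2 < 1)
    (hM : ∀ t : ℕ, ‖M ^ t‖ ≤ D * s ^ t) : Summable fun t : ℕ => γ ^ t • (M ^ t * Mᵀ ^ t) :=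
  (summable_geometric_bound hγ hγs).of_norm_bounded (norm_smul_pow_mul_transpose_pow_le hγ hM)

lemma summable_lyapunov (W : Matrix (Fin n) (Fin n) ℝ) (hγ : 0 ≤ γ) (hγs : γ * s ^ 2 < 1)
    (hM : ∀ t : ℕ, ‖M ^ t‖ ≤ D * s ^ t) :
    Summable fun t : ℕ => γ ^ t • (Mᵀ ^ t * W * M ^ t) := by
  refine ((summable_geometric_bound (D := D) hγ hγs).mul_left ‖W‖).of_norm_bounded fun t => ?_
  have hT : ‖Mᵀ ^ t‖ = ‖M ^ t‖ := by rw [← transpose_pow, frobenius_norm_transpose]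
  calc ‖γ ^ t • (Mᵀ ^ t * W * M ^ t)‖ ≤ γ ^ t * (‖Mᵀ ^ t‖ * ‖W‖ * ‖M ^ t‖) := by
        rw [norm_smul, Real.norm_of_nonneg (pow_nonneg hγ t)]
        gcongr
        exact norm_mul₃_le
    _ ≤ γ ^ t * ((D * s ^ t) * ‖W‖ * (D * s ^ t)) := by
        rw [hT]
        have := (norm_nonneg _).trans (hM t)
        gcongr
        · exact hM t
        · exact hM t
    _ = _ := by ring

lemma tsum_gramian_eq (h : Summable fun t : ℕ => γ ^ t • (M ^ t * Mᵀ ^ t)) :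
    ∑' t : ℕ, γ ^ t • (M ^ t * Mᵀ ^ t) =
      1 + γ • (M * (∑' t : ℕ, γ ^ t • (M ^ t * Mᵀ ^ t)) * Mᵀ) := by
  rw [← h.tsum_mul_left, ← (h.mul_left M).tsum_mul_right,
    ← ((h.mul_left M).mul_right Mᵀ).tsum_const_smul, h.tsum_eq_zero_add]
  simp only [pow_zero, one_smul, mul_one]
  congr 2
  funext t
  rw [pow_succ' M, pow_succ Mᵀ, pow_succ' γ]
  simp only [Matrix.mul_smul, Matrix.smul_mul, smul_smul, Matrix.mul_assoc]

lemma tsum_lyapunov_eq {W : Matrix (Fin n) (Fin n) ℝ}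
    (h : Summable fun t : ℕ => γ ^ t • (Mᵀ ^ t * W * M ^ t)) :
    ∑' t : ℕ, γ ^ t • (Mᵀ ^ t * W * M ^ t) =
      W + γ • (Mᵀ * (∑' t : ℕ, γ ^ t • (Mᵀ ^ t * W * M ^ t)) * M) := by
  rw [← h.tsum_mul_left, ← (h.mul_left Mᵀ).tsum_mul_right,
    ← ((h.mul_left Mᵀ).mul_right M).tsum_const_smul, h.tsum_eq_zero_add]
  simp only [pow_zero, one_smul, mul_one, one_mul]
  congr 2
  funext t
  rw [pow_succ M, pow_succ' Mᵀ, pow_succ' γ]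
  simp only [Matrix.mul_smul, Matrix.smul_mul, smul_smul, Matrix.mul_assoc]

lemma tsum_trace_eq_trace_mul_gramian (W : Matrix (Fin n) (Fin n) ℝ)
    (h : Summable fun t : ℕ => γ ^ t • (M ^ t * Mᵀ ^ t)) :
    ∑' t : ℕ, γ ^ t * (Mᵀ ^ t * W * M ^ t).trace =
      (W * ∑' t : ℕ, γ ^ t • (M ^ t * Mᵀ ^ t)).trace := by
  rw [← h.tsum_mul_left]
  have htr := (h.mul_left W).hasSum.map (Matrix.traceAddMonoidHom (Fin n) ℝ)
    (Continuous.matrix_trace continuous_id)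
  refine Eq.trans ?_ htr.tsum_eq
  congr 1
  funext t
  simp only [Function.comp_apply, traceAddMonoidHom_apply, Matrix.mul_smul, trace_smul,
    smul_eq_mul]
  rw [Matrix.trace_mul_comm, ← Matrix.mul_assoc, Matrix.trace_mul_comm, ← Matrix.mul_assoc]

/-- The cost difference identity. -/
lemma trace_mul_eq_trace_add {W P S : Matrix (Fin n) (Fin n) ℝ}
    (hS : S = 1 + γ • (M * S * Mᵀ)) :
    (W * S).trace = P.trace + ((W + γ • (Mᵀ * P * M) - P) * S).trace := by
  have h1 : (P * S).trace = P.trace + (γ • (Mᵀ * P * M) * S).trace := by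
    conv_lhs => rw [hS]
    rw [mul_add, mul_one, trace_add]
    congr 1
    rw [Matrix.mul_smul, Matrix.smul_mul, trace_smul, trace_smul, ← Matrix.mul_assoc,
      Matrix.trace_mul_comm]
    simp only [Matrix.mul_assoc]
  rw [sub_mul, add_mul, trace_sub, trace_add, h1]
  ring

end GeometricBound

lemma continuous_Acl {n m p : ℕ} (A : Matrix (Fin n) (Fin n) ℝ) (B : Matrix (Fin n) (Fin m) ℝ)
    (C : Matrix (Fin p) (Fin n) ℝ) : Continuous (Acl A B C) := by
  unfold Acl
  fun_prop

/-- Geometric bound on the powers of the closed-loop matrices, uniform near a stabilizing gain. -/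
lemma exists_eventually_norm_Acl_pow_le {n m p : ℕ} {A : Matrix (Fin n) (Fin n) ℝ}
    {B : Matrix (Fin n) (Fin m) ℝ} {C : Matrix (Fin p) (Fin n) ℝ} {γ : ℝ} (hγ : 0 < γ)
    {K : Matrix (Fin m) (Fin p) ℝ} (hK : inS A B C γ K) :
    ∃ s D : ℝ, γ * s ^ 2 < 1 ∧
      ∀ᶠ K' in 𝓝 K, ∀ t : ℕ, ‖Acl A B C K' ^ t‖ ≤ D * s ^ t := by
  have hsq : 0 < √γ := Real.sqrt_pos.2 hγ
  have hρ : 0 ≤ specRad (Acl A B C K) :=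
    Real.sSup_nonneg (by rintro _ ⟨μ, -, rfl⟩; exact norm_nonneg μ)
  obtain ⟨s, hs1, hs2⟩ := exists_between ((lt_div_iff₀' hsq).2 hK)
  have hs0 : 0 < s := hρ.trans_lt hs1
  obtain ⟨N, hN, hlt⟩ := exists_norm_pow_lt_of_specRad_lt _ hs1
  obtain ⟨D, hD⟩ := exists_eventually_norm_pow_le _ hs0 hN hlt
  refine ⟨s, D, ?_, (continuous_Acl A B C).continuousAt.eventually hD⟩
  have h1 : √γ * s < 1 := (lt_div_iff₀' hsq).1 hs2
  calc γ * s ^ 2 = (√γ * s) ^ 2 := by rw [mul_pow, Real.sq_sqrt hγ.le]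
    _ < 1 := pow_lt_one₀ (by positivity) h1 two_ne_zero

lemma continuousAt_Smat {n m p : ℕ} {A : Matrix (Fin n) (Fin n) ℝ}
    {B : Matrix (Fin n) (Fin m) ℝ} {C : Matrix (Fin p) (Fin n) ℝ} {γ : ℝ} (hγ : 0 < γ)
    {K : Matrix (Fin m) (Fin p) ℝ} (hK : inS A B C γ K) :
    ContinuousAt (Smat A B C γ) K := by
  obtain ⟨s, D, hs, hD⟩ := exists_eventually_norm_Acl_pow_le hγ hK
  have hc := continuous_Acl A B C
  refine tendsto_tsum_of_dominated_convergence (summable_geometric_bound (D := D) hγ.le hs)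
    (fun t => ?_) (hD.mono fun K' h => norm_smul_pow_mul_transpose_pow_le hγ.le h)
  exact Continuous.tendsto (by fun_prop) K

lemma isSymm_Pmat {n m p : ℕ} (A : Matrix (Fin n) (Fin n) ℝ) (B : Matrix (Fin n) (Fin m) ℝ)
    (C : Matrix (Fin p) (Fin n) ℝ) {Q : Matrix (Fin n) (Fin n) ℝ} {R : Matrix (Fin m) (Fin m) ℝ}
    (hQ : Q.IsSymm) (hR : R.IsSymm) (γ : ℝ) (K : Matrix (Fin m) (Fin p) ℝ) :
    (Pmat A B C Q R γ K)ᵀ = Pmat A B C Q R γ K := by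
  unfold Pmat
  rw [Matrix.transpose_tsum]
  congr 1
  funext t
  simp only [transpose_smul, transpose_mul, transpose_add, transpose_pow, transpose_transpose,
    hQ.eq, hR.eq, Matrix.mul_assoc]

lemma isSymm_Smat {n m p : ℕ} (A : Matrix (Fin n) (Fin n) ℝ) (B : Matrix (Fin n) (Fin m) ℝ)
    (C : Matrix (Fin p) (Fin n) ℝ) (γ : ℝ) (K : Matrix (Fin m) (Fin p) ℝ) :
    (Smat A B C γ K)ᵀ = Smat A B C γ K := by
  unfold Smat
  rw [Matrix.transpose_tsum]
  congr 1
  funext t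
  simp only [transpose_smul, transpose_mul, transpose_pow, transpose_transpose]

/-- Second-order expansion of the Lyapunov residual around a solution `P`. -/
lemma lyapunov_residual_eq {n m p : ℕ} {A : Matrix (Fin n) (Fin n) ℝ}
    {B : Matrix (Fin n) (Fin m) ℝ} {C : Matrix (Fin p) (Fin n) ℝ} {Q P : Matrix (Fin n) (Fin n) ℝ}
    {R : Matrix (Fin m) (Fin m) ℝ} (hR : Rᵀ = R) (hP : Pᵀ = P) {γ : ℝ}
    {K H : Matrix (Fin m) (Fin p) ℝ} {E : Matrix (Fin m) (Fin n) ℝ}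
    (hE : E = (R + γ • (Bᵀ * P * B)) * K * C - γ • (Bᵀ * P * A))
    (hlyap : P = Q + Cᵀ * Kᵀ * R * K * C + γ • ((Acl A B C K)ᵀ * P * Acl A B C K)) :
    Q + Cᵀ * (K + H)ᵀ * R * (K + H) * C
        + γ • ((Acl A B C (K + H))ᵀ * P * Acl A B C (K + H)) - P =
      (H * C)ᵀ * E + Eᵀ * (H * C) + (H * C)ᵀ * (R + γ • (Bᵀ * P * B)) * (H * C) := by
  conv_lhs => rw [sub_eq_add_neg]; arg 2; rw [hlyap]
  subst hE
  simp only [Acl, transpose_add, transpose_sub, transpose_mul, transpose_smul, transpose_transpose,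
    hR, hP, Matrix.mul_add, Matrix.add_mul, Matrix.mul_sub, Matrix.sub_mul, Matrix.mul_smul,
    Matrix.smul_mul, smul_add, smul_sub, Matrix.mul_assoc]
  abel

/-- Differentiability of the discounted cost at a stabilizing gain, for symmetric weights. -/
lemma exists_hasFDerivAt_cost {n m p : ℕ} (A : Matrix (Fin n) (Fin n) ℝ)
    (B : Matrix (Fin n) (Fin m) ℝ) (C : Matrix (Fin p) (Fin n) ℝ)
    {Q : Matrix (Fin n) (Fin n) ℝ} {R : Matrix (Fin m) (Fin m) ℝ}
    (hQsymm : Q.IsSymm) (hRsymm : R.IsSymm) {γ : ℝ} (hγ0 : 0 < γ)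
    {K : Matrix (Fin m) (Fin p) ℝ} (hK : inS A B C γ K) :
    ∃ Lder : Matrix (Fin m) (Fin p) ℝ →L[ℝ] ℝ,
      (∀ H : Matrix (Fin m) (Fin p) ℝ, Lder H = ((gradJ A B C Q R γ K)ᵀ * H).trace) ∧
      HasFDerivAt (fun K' : Matrix (Fin m) (Fin p) ℝ =>
          ∑' t : ℕ, γ ^ t *
            ((Acl A B C K')ᵀ ^ t * (Q + Cᵀ * K'ᵀ * R * K' * C) * (Acl A B C K') ^ t).trace)
        Lder K := by
  obtain ⟨s, D, hs, hD⟩ := exists_eventually_norm_Acl_pow_le hγ0 hK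
  have hDK := hD.self_of_nhds
  set P := Pmat A B C Q R γ K
  set E := Egrad A B C Q R γ K with hEdef
  set S := Smat A B C γ K with hSdef
  have hP : Pᵀ = P := isSymm_Pmat A B C hQsymm hRsymm γ K
  have hS : Sᵀ = S := isSymm_Smat A B C γ K
  have hlyap := tsum_lyapunov_eq (summable_lyapunov (Q + Cᵀ * Kᵀ * R * K * C) hγ0.le hs hDK)
  set N := R + γ • (Bᵀ * P * B)
  let J : Matrix (Fin m) (Fin p) ℝ → ℝ := fun K' => ∑' t : ℕ, γ ^ t *
    ((Acl A B C K')ᵀ ^ t * (Q + Cᵀ * K'ᵀ * R * K' * C) * (Acl A B C K') ^ t).trace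
  let L : Matrix (Fin m) (Fin p) ℝ →ₗ[ℝ] Matrix (Fin n) (Fin n) ℝ :=
    { toFun := fun H => (H * C)ᵀ * E + Eᵀ * (H * C)
      map_add' := fun X Y => by
        simp only [Matrix.add_mul, transpose_add, Matrix.mul_add]
        abel
      map_smul' := fun c X => by
        simp only [Matrix.smul_mul, transpose_smul, Matrix.mul_smul, smul_add, RingHom.id_apply] }
  let Lder : Matrix (Fin m) (Fin p) ℝ →ₗ[ℝ] ℝ :=
    Matrix.traceLinearMap (Fin n) ℝ ℝ ∘ₗ LinearMap.mulRight ℝ S ∘ₗ L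
  have hLder : ∀ H, Lder H = (((H * C)ᵀ * E + Eᵀ * (H * C)) * S).trace := fun H => rfl
  have hexp : ∀ᶠ K' in 𝓝 K, J K' = P.trace + ((L (K' - K) +
      ((K' - K) * C)ᵀ * N * ((K' - K) * C)) * Smat A B C γ K').trace := by
    filter_upwards [hD] with K' hK'
    have hsum := summable_gramian hγ0.le hs hK'
    have hres := lyapunov_residual_eq (H := K' - K) hRsymm.eq hP hEdef hlyap
    rw [add_sub_cancel] at hres
    change _ = _ + (((((K' - K) * C)ᵀ * E + Eᵀ * ((K' - K) * C)) + _) * _).trace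
    rw [← hres]
    exact (tsum_trace_eq_trace_mul_gramian _ hsum).trans
      (trace_mul_eq_trace_add (tsum_gramian_eq hsum))
  have hJK : J K = P.trace := by
    rw [hexp.self_of_nhds]
    simp
  refine ⟨LinearMap.toContinuousLinearMap Lder, fun H => ?_, ?_⟩
  · rw [LinearMap.coe_toContinuousLinearMap', hLder]
    have h1 : (((H * C)ᵀ * E) * S).trace = (Eᵀ * (H * C) * S).trace := by
      rw [← trace_transpose]
      simp only [transpose_mul, transpose_transpose, hS]
      rw [Matrix.trace_mul_comm]
    rw [Matrix.add_mul, trace_add, h1, ← two_mul]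
    simp only [gradJ, transpose_smul, transpose_mul, transpose_transpose, Matrix.smul_mul,
      trace_smul, smul_eq_mul, ← hEdef, ← hSdef, hS]
    congr 1
    rw [Matrix.trace_mul_comm (Eᵀ * (H * C)) S, Matrix.mul_assoc C, Matrix.trace_mul_comm C]
    simp only [Matrix.mul_assoc]
  · refine HasFDerivAt.of_isLittleO ?_
    change (fun K' => J K' - J K - Lder (K' - K)) =o[𝓝 K] fun K' => K' - K
    have hL : (fun K' => L (K' - K)) =O[𝓝 K] fun K' => K' - K :=
      (LinearMap.toContinuousLinearMap L).isBigO_sub _ _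
    have hSc : ContinuousAt (Smat A B C γ) K := continuousAt_Smat hγ0 hK
    have hS1 : (fun K' => Smat A B C γ K' - S) =o[𝓝 K] fun _ => (1 : ℝ) :=
      (isLittleO_one_iff ℝ).2 (tendsto_sub_nhds_zero_iff.2 hSc)
    have hS2 : Smat A B C γ =O[𝓝 K] fun _ => (1 : ℝ) := hSc.isBigO_one ℝ
    have hquad : (fun K' => ((K' - K) * C)ᵀ * N * ((K' - K) * C)) =o[𝓝 K] fun K' => K' - K := by
      have hO : (fun K' => ((K' - K) * C)ᵀ * N * ((K' - K) * C)) =O[𝓝 K]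
          fun K' => ‖K' - K‖ ^ 2 := by
        refine IsBigO.of_bound (‖C‖ ^ 2 * ‖N‖) (Eventually.of_forall fun K' => ?_)
        have h1 := frobenius_norm_mul (K' - K) C
        calc ‖((K' - K) * C)ᵀ * N * ((K' - K) * C)‖
            ≤ ‖((K' - K) * C)ᵀ‖ * ‖N‖ * ‖(K' - K) * C‖ :=
              (frobenius_norm_mul _ _).trans
                (mul_le_mul_of_nonneg_right (frobenius_norm_mul _ _) (norm_nonneg _))
          _ ≤ (‖K' - K‖ * ‖C‖) * ‖N‖ * (‖K' - K‖ * ‖C‖) := by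
              rw [frobenius_norm_transpose]
              gcongr
          _ = ‖C‖ ^ 2 * ‖N‖ * ‖‖K' - K‖ ^ 2‖ := by
              rw [Real.norm_of_nonneg (by positivity)]
              ring
      exact hO.trans_isLittleO (isLittleO_pow_sub_sub K one_lt_two)
    have hrem : (fun K' => L (K' - K) * (Smat A B C γ K' - S) +
        ((K' - K) * C)ᵀ * N * ((K' - K) * C) * Smat A B C γ K') =o[𝓝 K] fun K' => K' - K := by
      have h1 := hL.norm_right.mul_isLittleO hS1
      have h2 := hquad.norm_right.mul_isBigO hS2
      simpa using (h1.add h2)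
    refine IsLittleO.congr' (((LinearMap.toContinuousLinearMap
      (Matrix.traceLinearMap (Fin n) ℝ ℝ)).isBigO_comp _ _).trans_isLittleO hrem) ?_ .rfl
    filter_upwards [hexp] with K' hK'
    rw [hK', hJK]
    change (_ : Matrix (Fin n) (Fin n) ℝ).trace = _ + _ - _ - (L (K' - K) * S).trace
    rw [Matrix.mul_sub, Matrix.add_mul, trace_add, trace_add, trace_sub]
    ring

end StableMatrices

/-- the (everywhere-defined) discounted cost is Fréchet differentiable at any
`K ∈ S_γ`, with gradient `2 E_K Σ_K(γ) Cᵀ` w.r.t. the Frobenius inner product. -/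
theorem stmt0
    {n m p : ℕ} (hn : 1 ≤ n) (hm : 1 ≤ m) (hp : 1 ≤ p)
    (A : Matrix (Fin n) (Fin n) ℝ) (B : Matrix (Fin n) (Fin m) ℝ) (C : Matrix (Fin p) (Fin n) ℝ)
    (Q : Matrix (Fin n) (Fin n) ℝ) (R : Matrix (Fin m) (Fin m) ℝ)
    (hQsymm : Q.IsSymm) (hRsymm : R.IsSymm)
    (ℓ₀ ℓ₁ ψ φ : ℝ) (hℓ₀ : 0 < ℓ₀) (hℓ₀₁ : ℓ₀ ≤ ℓ₁) (hψ : 1 ≤ ψ) (hφ : 1 ≤ φ)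
    (hQlb : (Q - ℓ₀ • (1 : Matrix (Fin n) (Fin n) ℝ)).PosSemidef)
    (hQub : (ℓ₁ • (1 : Matrix (Fin n) (Fin n) ℝ) - Q).PosSemidef)
    (hRlb : (R - ℓ₀ • (1 : Matrix (Fin m) (Fin m) ℝ)).PosSemidef)
    (hRub : (ℓ₁ • (1 : Matrix (Fin m) (Fin m) ℝ) - R).PosSemidef)
    (hB : spNorm B ≤ ψ) (hC : spNorm C ≤ φ)
    (γ : ℝ) (hγ : γ ∈ Set.Ioc (0 : ℝ) 1)
    (K : Matrix (Fin m) (Fin p) ℝ) (hK : inS A B C γ K) :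
    ∃ Lder : Matrix (Fin m) (Fin p) ℝ →L[ℝ] ℝ,
      (∀ H : Matrix (Fin m) (Fin p) ℝ, Lder H = ((gradJ A B C Q R γ K)ᵀ * H).trace) ∧
      HasFDerivAt (fun K' : Matrix (Fin m) (Fin p) ℝ =>
          ∑' t : ℕ, γ ^ t *
            ((Acl A B C K')ᵀ ^ t * (Q + Cᵀ * K'ᵀ * R * K' * C) * (Acl A B C K') ^ t).trace)
        Lder K := by
  exact exists_hasFDerivAt_cost A B C hQsymm hRsymm hγ.1 hK
end

section
/- Let γ ∈ (0,1], ν > 0, K ∈ S_γ(ν), and let K' ∈ ℝ^{m×p} satisfy ‖K − K'‖ ≤ D where D = 1/(8κ³ψφ). Then K' ∈ S_γ and ‖Σ_K(γ) − Σ_{K'}(γ)‖ ≤ 6κ⁵ψφ·‖K − K'‖. -/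
open Matrix

open Filter Topology

/-- Membership in `S_γ` says that `√γ (A - BKC)` is Schur stable. -/
theorem sqrt_mul_specRad_lt_one_iff {n : ℕ} (hn : 1 ≤ n) (M : Matrix (Fin n) (Fin n) ℝ)
    {s : ℝ} (hs : 0 < s) :
    s * specRad M < 1 ↔ ∀ μ ∈ spectrum ℂ ((s • M).map (algebraMap ℝ ℂ)), ‖μ‖ < 1 := by
  have : Nonempty (Fin n) := ⟨⟨0, hn⟩⟩
  have hne : (spectrum ℂ (M.map (algebraMap ℝ ℂ))).Nonempty :=
    spectrum.nonempty_of_isAlgClosed_of_finiteDimensional ℂ _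
  have hmap : (s • M).map (algebraMap ℝ ℂ) = (s : ℂ) • M.map (algebraMap ℝ ℂ) := by
    ext i j; simp
  have hset : {r : ℝ | ∃ μ ∈ spectrum ℂ (M.map (algebraMap ℝ ℂ)), r = ‖μ‖}
      = norm '' spectrum ℂ (M.map (algebraMap ℝ ℂ)) := by
    ext r; simp [eq_comm]
  have hfin : (norm '' spectrum ℂ (M.map (algebraMap ℝ ℂ))).Finite :=
    (Matrix.finite_spectrum _).image _
  rw [hmap, spectrum.smul_eq_smul _ _ hne, mul_comm, ← lt_div_iff₀ hs, specRad, hset,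
    Set.Finite.csSup_lt_iff hfin (hne.image _)]
  simp only [Set.forall_mem_image, Set.mem_smul_set, forall_exists_index, and_imp,
    forall_apply_eq_imp_iff₂, lt_div_iff₀ hs, smul_eq_mul, norm_mul, Complex.norm_real,
    Real.norm_of_nonneg hs.le, mul_comm s]

section Frobenius

open scoped Matrix.Norms.Frobenius

theorem summable_norm_pow_sq {n : ℕ} (hn : 1 ≤ n) {M : Matrix (Fin n) (Fin n) ℝ}
    (hM : ∀ μ ∈ spectrum ℂ (M.map (algebraMap ℝ ℂ)), ‖μ‖ < 1) :
    Summable fun t : ℕ => ‖M ^ t‖ ^ 2 := by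
  have : Nonempty (Fin n) := ⟨⟨0, hn⟩⟩
  have h1 : spectralRadius ℂ (M.map (algebraMap ℝ ℂ)) < (1 : NNReal) :=
    spectrum.spectralRadius_lt_of_forall_lt _ fun k hk => by exact_mod_cast hM k hk
  obtain ⟨r, hr0, hr1⟩ := ENNReal.lt_iff_exists_nnreal_btwn.1 h1
  have hr1' : r < 1 := by exact_mod_cast hr1
  have hG := (spectrum.pow_nnnorm_pow_one_div_tendsto_nhds_spectralRadius
    (M.map (algebraMap ℝ ℂ))).eventually_lt_const hr0
  have hle : ∀ᶠ t : ℕ in atTop, ‖M ^ t‖ ^ 2 ≤ ((r : ℝ) ^ 2) ^ t := by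
    filter_upwards [hG, eventually_gt_atTop 0] with t ht ht0
    have hnorm : ‖(M.map (algebraMap ℝ ℂ)) ^ t‖₊ = ‖M ^ t‖₊ := by
      rw [← Matrix.map_pow]
      exact Matrix.frobenius_nnnorm_map_eq _ _ fun a => by simp
    rw [hnorm] at ht
    have h3 : (‖M ^ t‖₊ : ENNReal) ≤ (r : ENNReal) ^ t := by
      have := ENNReal.rpow_le_rpow ht.le (Nat.cast_nonneg t : (0 : ℝ) ≤ t)
      rwa [← ENNReal.rpow_mul, one_div_mul_cancel (by positivity), ENNReal.rpow_one,
        ENNReal.rpow_natCast] at this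
    have h4 : ‖M ^ t‖ ≤ (r : ℝ) ^ t := by exact_mod_cast h3
    calc ‖M ^ t‖ ^ 2 ≤ ((r : ℝ) ^ t) ^ 2 := by gcongr
      _ = _ := by rw [← pow_mul, ← pow_mul, mul_comm]
  refine Summable.of_norm_bounded_eventually_nat
    (summable_geometric_of_lt_one (by positivity) (pow_lt_one₀ r.2 (by exact_mod_cast hr1') two_ne_zero))
    ?_
  filter_upwards [hle] with t ht
  rwa [Real.norm_of_nonneg (by positivity)]

/-- The Gramian series of a Schur stable matrix converges. -/
theorem summable_pow_mul_transpose_pow {n : ℕ} (hn : 1 ≤ n) {M : Matrix (Fin n) (Fin n) ℝ}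
    (hM : ∀ μ ∈ spectrum ℂ (M.map (algebraMap ℝ ℂ)), ‖μ‖ < 1) :
    Summable fun t : ℕ => M ^ t * Mᵀ ^ t := by
  refine Summable.of_norm_bounded (summable_norm_pow_sq hn hM) fun t => ?_
  calc ‖M ^ t * Mᵀ ^ t‖ ≤ ‖M ^ t‖ * ‖Mᵀ ^ t‖ := norm_mul_le _ _
    _ = ‖M ^ t‖ ^ 2 := by
      rw [← Matrix.transpose_pow, Matrix.frobenius_norm_transpose, sq]

theorem summable_transpose_pow_mul_mul_pow {n : ℕ} (hn : 1 ≤ n) {M : Matrix (Fin n) (Fin n) ℝ}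
    (hM : ∀ μ ∈ spectrum ℂ (M.map (algebraMap ℝ ℂ)), ‖μ‖ < 1) (W : Matrix (Fin n) (Fin n) ℝ) :
    Summable fun t : ℕ => Mᵀ ^ t * W * M ^ t := by
  refine Summable.of_norm_bounded ((summable_norm_pow_sq hn hM).mul_left ‖W‖) fun t => ?_
  calc ‖Mᵀ ^ t * W * M ^ t‖ ≤ ‖Mᵀ ^ t‖ * ‖W‖ * ‖M ^ t‖ :=
        (norm_mul_le _ _).trans (by gcongr; exact norm_mul_le _ _)
    _ = ‖W‖ * ‖M ^ t‖ ^ 2 := by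
      rw [← Matrix.transpose_pow, Matrix.frobenius_norm_transpose]; ring

end Frobenius

section SpectralNorm

open scoped Matrix.Norms.L2Operator

theorem spNorm_nonneg {a b : ℕ} (M : Matrix (Fin a) (Fin b) ℝ) : 0 ≤ spNorm M := norm_nonneg _

theorem spNorm_mul_le {a b c : ℕ} (M : Matrix (Fin a) (Fin b) ℝ) (N : Matrix (Fin b) (Fin c) ℝ) :
    spNorm (M * N) ≤ spNorm M * spNorm N :=
  Matrix.l2_opNorm_mul M N

theorem spNorm_smul {a b : ℕ} (s : ℝ) (M : Matrix (Fin a) (Fin b) ℝ) :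
    spNorm (s • M) = |s| * spNorm M :=
  norm_smul s M

theorem spNorm_transpose {a b : ℕ} (M : Matrix (Fin a) (Fin b) ℝ) : spNorm Mᵀ = spNorm M := by
  rw [← Matrix.conjTranspose_eq_transpose_of_trivial]
  exact Matrix.l2_opNorm_conjTranspose M

end SpectralNorm

theorem norm_toLp_sq {a : ℕ} (x : Fin a → ℝ) : ‖WithLp.toLp 2 x‖ ^ 2 = x ⬝ᵥ x := by
  rw [EuclideanSpace.norm_sq_eq]
  simp [dotProduct, sq]

theorem dotProduct_self_nonneg {a : ℕ} (x : Fin a → ℝ) : 0 ≤ x ⬝ᵥ x :=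
  norm_toLp_sq x ▸ sq_nonneg _

theorem mulVec_dotProduct_self_le {a b : ℕ} (M : Matrix (Fin a) (Fin b) ℝ) (x : Fin b → ℝ) :
    (M *ᵥ x) ⬝ᵥ (M *ᵥ x) ≤ spNorm M ^ 2 * (x ⬝ᵥ x) := by
  rw [← norm_toLp_sq, ← norm_toLp_sq, ← mul_pow]
  gcongr
  exact (LinearMap.toContinuousLinearMap (Matrix.toEuclideanLin M)).le_opNorm (WithLp.toLp 2 x)

theorem vecMul_dotProduct_self_le {a b : ℕ} (M : Matrix (Fin a) (Fin b) ℝ) (x : Fin a → ℝ) :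
    (x ᵥ* M) ⬝ᵥ (x ᵥ* M) ≤ spNorm M ^ 2 * (x ⬝ᵥ x) := by
  rw [← Matrix.mulVec_transpose, ← spNorm_transpose]
  exact mulVec_dotProduct_self_le _ x

theorem dotProduct_mulVec_symm {n : ℕ} {S : Matrix (Fin n) (Fin n) ℝ} (hS : S.IsSymm)
    (x y : Fin n → ℝ) : x ⬝ᵥ S *ᵥ y = y ⬝ᵥ S *ᵥ x := by
  rw [Matrix.dotProduct_mulVec, ← Matrix.mulVec_transpose, hS.eq, dotProduct_comm]

/-- Cauchy–Schwarz for a positive semidefinite form. -/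
theorem sq_dotProduct_mulVec_le {n : ℕ} {S : Matrix (Fin n) (Fin n) ℝ} (hS : S.IsSymm)
    (hS0 : ∀ x, 0 ≤ x ⬝ᵥ S *ᵥ x) (x y : Fin n → ℝ) :
    (x ⬝ᵥ S *ᵥ y) ^ 2 ≤ (x ⬝ᵥ S *ᵥ x) * (y ⬝ᵥ S *ᵥ y) := by
  have h := discrim_le_zero (a := x ⬝ᵥ S *ᵥ x) (b := 2 * (x ⬝ᵥ S *ᵥ y)) (c := y ⬝ᵥ S *ᵥ y)
    fun t => by
      have := hS0 (t • x + y)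
      simp only [Matrix.mulVec_add, Matrix.mulVec_smul, add_dotProduct, dotProduct_add,
        smul_dotProduct, dotProduct_smul, smul_eq_mul, dotProduct_mulVec_symm hS y x] at this
      linarith
  rw [discrim] at h
  linarith

/-- The spectral norm of a symmetric matrix is controlled by its quadratic form. -/
theorem spNorm_le_of_abs_dotProduct_le {n : ℕ} {D : Matrix (Fin n) (Fin n) ℝ} (hD : D.IsSymm)
    {c : ℝ} (hc : 0 ≤ c) (h : ∀ x, |x ⬝ᵥ D *ᵥ x| ≤ c * (x ⬝ᵥ x)) : spNorm D ≤ c := by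
  have hpol : ∀ x y : Fin n → ℝ, 2 * (x ⬝ᵥ D *ᵥ y) ≤ c * (x ⬝ᵥ x + y ⬝ᵥ y) := fun x y => by
    have h1 := (abs_le.1 (h (x + y))).2
    have h2 := (abs_le.1 (h (x - y))).1
    simp only [Matrix.mulVec_add, Matrix.mulVec_sub, add_dotProduct, dotProduct_add,
      sub_dotProduct, dotProduct_sub, dotProduct_mulVec_symm hD y x, dotProduct_comm y x] at h1 h2
    linarith
  refine ContinuousLinearMap.opNorm_le_bound _ hc fun v => ?_
  obtain ⟨x, rfl⟩ : ∃ x, v = WithLp.toLp 2 x := ⟨v.ofLp, rfl⟩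
  change ‖WithLp.toLp 2 (D *ᵥ x)‖ ≤ c * ‖WithLp.toLp 2 x‖
  set u := ‖WithLp.toLp 2 x‖ with hu
  set w := ‖WithLp.toLp 2 (D *ᵥ x)‖ with hw
  have hu2 : x ⬝ᵥ x = u ^ 2 := (norm_toLp_sq x).symm
  have hw2 : (D *ᵥ x) ⬝ᵥ (D *ᵥ x) = w ^ 2 := (norm_toLp_sq _).symm
  have hu0 : 0 ≤ u := norm_nonneg _
  have hw0 : 0 ≤ w := norm_nonneg _
  rcases hw0.eq_or_lt with h0 | h0
  · rw [← h0]; positivity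
  have key := hpol ((u / w) • (D *ᵥ x)) x
  simp only [smul_dotProduct, dotProduct_smul, smul_eq_mul, hu2, hw2] at key
  have e1 : u / w * w ^ 2 = u * w := by field_simp
  have e2 : u / w * (u / w * w ^ 2) = u ^ 2 := by field_simp
  rw [e2, e1] at key
  rcases hu0.eq_or_lt with h1 | h1
  · have hx : x = 0 := by
      have := norm_eq_zero.1 h1.symm
      simpa using this
    simp [hw, hx] at h0
  · nlinarith

theorem hasSum_dotProduct_mulVec {n : ℕ} {f : ℕ → Matrix (Fin n) (Fin n) ℝ}
    {S : Matrix (Fin n) (Fin n) ℝ} (h : HasSum f S) (x y : Fin n → ℝ) :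
    HasSum (fun t => x ⬝ᵥ f t *ᵥ y) (x ⬝ᵥ S *ᵥ y) :=
  h.map (AddMonoidHom.mk' (fun N : Matrix (Fin n) (Fin n) ℝ => x ⬝ᵥ N *ᵥ y)
    fun N L => by rw [Matrix.add_mulVec, dotProduct_add])
    (by change Continuous fun N : Matrix (Fin n) (Fin n) ℝ => x ⬝ᵥ N *ᵥ y; fun_prop)

theorem hasSum_trace {n : ℕ} {f : ℕ → Matrix (Fin n) (Fin n) ℝ}
    {S : Matrix (Fin n) (Fin n) ℝ} (h : HasSum f S) : HasSum (fun t => (f t).trace) S.trace :=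
  h.map (Matrix.traceAddMonoidHom (Fin n) ℝ) (continuous_id.matrix_trace)

theorem dotProduct_mul_transpose_mulVec {n : ℕ} (N S : Matrix (Fin n) (Fin n) ℝ)
    (x : Fin n → ℝ) : x ⬝ᵥ (N * S * Nᵀ) *ᵥ x = (x ᵥ* N) ⬝ᵥ S *ᵥ (x ᵥ* N) := by
  rw [← Matrix.mulVec_mulVec, ← Matrix.mulVec_mulVec, Matrix.dotProduct_mulVec,
    Matrix.mulVec_transpose]

theorem dotProduct_pow_mul_transpose_pow_mulVec {n : ℕ} (M : Matrix (Fin n) (Fin n) ℝ) (t : ℕ)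
    (x : Fin n → ℝ) : x ⬝ᵥ (M ^ t * Mᵀ ^ t) *ᵥ x = (x ᵥ* M ^ t) ⬝ᵥ (x ᵥ* M ^ t) := by
  have := dotProduct_mul_transpose_mulVec (M ^ t) 1 x
  rwa [Matrix.mul_one, Matrix.one_mulVec, Matrix.transpose_pow] at this

/-- The controllability Gramian `∑ M^t (Mᵀ)^t`. -/
noncomputable def gramian {n : ℕ} (M : Matrix (Fin n) (Fin n) ℝ) : Matrix (Fin n) (Fin n) ℝ :=
  ∑' t : ℕ, M ^ t * Mᵀ ^ t

section Gramian

variable {n : ℕ} {M : Matrix (Fin n) (Fin n) ℝ}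

theorem hasSum_gramian_form (h : Summable fun t : ℕ => M ^ t * Mᵀ ^ t) (x : Fin n → ℝ) :
    HasSum (fun t : ℕ => (x ᵥ* M ^ t) ⬝ᵥ (x ᵥ* M ^ t)) (x ⬝ᵥ gramian M *ᵥ x) := by
  have := hasSum_dotProduct_mulVec h.hasSum x x
  simp only [dotProduct_pow_mul_transpose_pow_mulVec] at this
  exact this

theorem gramian_isSymm (M : Matrix (Fin n) (Fin n) ℝ) : (gramian M).IsSymm := by
  rw [Matrix.IsSymm, gramian, Matrix.transpose_tsum]
  simp only [Matrix.transpose_mul, Matrix.transpose_pow, Matrix.transpose_transpose]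

/-- The discrete Lyapunov equation. -/
theorem mul_gramian_mul_transpose (h : Summable fun t : ℕ => M ^ t * Mᵀ ^ t) :
    M * gramian M * Mᵀ = gramian M - 1 := by
  have h1 : HasSum (fun t : ℕ => M ^ (t + 1) * Mᵀ ^ (t + 1)) (M * gramian M * Mᵀ) := by
    have h0 := (h.hasSum.mul_left M).mul_right Mᵀ
    simp only [pow_succ' M, pow_succ Mᵀ, mul_assoc] at h0 ⊢
    exact h0
  have h2 := (hasSum_nat_add_iff' (f := fun t : ℕ => M ^ t * Mᵀ ^ t) 1).2 h.hasSum
  simp only [Finset.sum_range_one, pow_zero, mul_one] at h2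
  exact h1.unique h2

theorem dotProduct_self_le_gramian_form (h : Summable fun t : ℕ => M ^ t * Mᵀ ^ t)
    (x : Fin n → ℝ) : x ⬝ᵥ x ≤ x ⬝ᵥ gramian M *ᵥ x := by
  have := le_hasSum (hasSum_gramian_form h x) 0 fun t _ => dotProduct_self_nonneg _
  simpa using this

theorem vecMul_dotProduct_self_le_trace (N : Matrix (Fin n) (Fin n) ℝ) (x : Fin n → ℝ) :
    (x ᵥ* N) ⬝ᵥ (x ᵥ* N) ≤ (N * Nᵀ).trace * (x ⬝ᵥ x) := by
  have hT : (N * Nᵀ).trace = ∑ i, ∑ j, N j i ^ 2 := by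
    rw [Finset.sum_comm]
    simp [Matrix.trace, Matrix.mul_apply, sq]
  rw [hT, Finset.sum_mul]
  refine Finset.sum_le_sum fun i _ => ?_
  have := Finset.sum_mul_sq_le_sq_mul_sq Finset.univ x fun j => N j i
  simp only [Matrix.vecMul, dotProduct, ← sq]
  linarith

theorem gramian_form_le_trace (h : Summable fun t : ℕ => M ^ t * Mᵀ ^ t) (x : Fin n → ℝ) :
    x ⬝ᵥ gramian M *ᵥ x ≤ (gramian M).trace * (x ⬝ᵥ x) := by
  refine hasSum_le (fun t => ?_) (hasSum_gramian_form h x)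
    ((hasSum_trace h.hasSum).mul_right (x ⬝ᵥ x))
  rw [← Matrix.transpose_pow]
  exact vecMul_dotProduct_self_le_trace _ x

/-- A cost weight bounded below by `ℓ` yields a cost bounded below by `ℓ` times the trace of the
Gramian. -/
theorem mul_trace_gramian_le (h : Summable fun t : ℕ => M ^ t * Mᵀ ^ t)
    {W : Matrix (Fin n) (Fin n) ℝ} (hW : Summable fun t : ℕ => Mᵀ ^ t * W * M ^ t) {ℓ : ℝ}
    (hℓ : (W - ℓ • (1 : Matrix (Fin n) (Fin n) ℝ)).PosSemidef) :
    ℓ * (gramian M).trace ≤ (∑' t : ℕ, Mᵀ ^ t * W * M ^ t).trace := by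
  refine hasSum_le (fun t => ?_) ((hasSum_trace h.hasSum).mul_left ℓ) (hasSum_trace hW.hasSum)
  have h1 := (hℓ.conjTranspose_mul_mul_same (M ^ t)).trace_nonneg
  rw [Matrix.conjTranspose_eq_transpose_of_trivial, Matrix.transpose_pow, Matrix.mul_sub,
    Matrix.sub_mul, Matrix.trace_sub, Matrix.mul_smul, Matrix.smul_mul, Matrix.mul_one,
    Matrix.trace_smul, smul_eq_mul, Matrix.trace_mul_comm (Mᵀ ^ t) (M ^ t)] at h1
  linarith

end Gramian

section Perturbation

variable {n : ℕ} {N S E : Matrix (Fin n) (Fin n) ℝ} {ε : ℝ}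

/-- A strict Lyapunov inequality certifies Schur stability. -/
theorem norm_lt_one_of_lyapunov (hS : S.IsSymm) (hS1 : ∀ x, x ⬝ᵥ x ≤ x ⬝ᵥ S *ᵥ x)
    (hNS : N * S * Nᵀ = S - 1 + E) (hε : ε < 1) (hE : ∀ x, |x ⬝ᵥ E *ᵥ x| ≤ ε * (x ⬝ᵥ x)) :
    ∀ μ ∈ spectrum ℂ (N.map (algebraMap ℝ ℂ)), ‖μ‖ < 1 := by
  intro μ hμ
  rw [spectrum.mem_iff, Matrix.isUnit_iff_isUnit_det, isUnit_iff_ne_zero, not_not] at hμ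
  obtain ⟨v, hv0, hv⟩ := Matrix.exists_vecMul_eq_zero_iff.2 hμ
  rw [Matrix.vecMul_sub, sub_eq_zero, Algebra.algebraMap_eq_smul_one] at hv
  have hvi : ∀ i, μ * v i = ∑ j, v j * (N j i : ℂ) := fun i => by
    have := congrFun hv i
    rw [Matrix.vecMul_smul, Matrix.vecMul_one] at this
    exact this
  set a : Fin n → ℝ := fun i => (v i).re with ha
  set b : Fin n → ℝ := fun i => (v i).im with hb
  have haN : a ᵥ* N = μ.re • a - μ.im • b := by
    ext i
    have := congrArg Complex.re (hvi i)
    simp only [Complex.mul_re, Complex.re_sum, Complex.ofReal_re, Complex.ofReal_im, mul_zero,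
      sub_zero] at this
    simp [Matrix.vecMul, dotProduct, ha, hb, this]
  have hbN : b ᵥ* N = μ.re • b + μ.im • a := by
    ext i
    have := congrArg Complex.im (hvi i)
    simp only [Complex.mul_im, Complex.im_sum, Complex.ofReal_re, Complex.ofReal_im, mul_zero,
      zero_add] at this
    simp [Matrix.vecMul, dotProduct, ha, hb, this]
  have hpos : 0 < a ⬝ᵥ a + b ⬝ᵥ b := by
    refine lt_of_le_of_ne (add_nonneg (dotProduct_self_nonneg a) (dotProduct_self_nonneg b))
      fun h0 => hv0 ?_
    have ha0 : a = 0 := dotProduct_self_eq_zero.1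
      (by linarith [dotProduct_self_nonneg a, dotProduct_self_nonneg b])
    have hb0 : b = 0 := dotProduct_self_eq_zero.1
      (by linarith [dotProduct_self_nonneg a, dotProduct_self_nonneg b])
    ext i
    exact Complex.ext (congrFun ha0 i) (congrFun hb0 i)
  have form : ∀ x, (x ᵥ* N) ⬝ᵥ S *ᵥ (x ᵥ* N) ≤ x ⬝ᵥ S *ᵥ x - (1 - ε) * (x ⬝ᵥ x) := fun x => by
    rw [← dotProduct_mul_transpose_mulVec, hNS, Matrix.add_mulVec, Matrix.sub_mulVec,
      Matrix.one_mulVec, dotProduct_add, dotProduct_sub]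
    linarith [(abs_le.1 (hE x)).2]
  have h1 := form a
  have h2 := form b
  rw [haN] at h1
  rw [hbN] at h2
  simp only [Matrix.mulVec_add, Matrix.mulVec_sub, Matrix.mulVec_smul, add_dotProduct,
    dotProduct_add, sub_dotProduct, dotProduct_sub, smul_dotProduct, dotProduct_smul,
    smul_eq_mul, dotProduct_mulVec_symm hS b a] at h1 h2
  have hμ2 : ‖μ‖ ^ 2 = μ.re * μ.re + μ.im * μ.im := by
    rw [← Complex.normSq_eq_norm_sq, Complex.normSq_apply]
  have hq : a ⬝ᵥ a + b ⬝ᵥ b ≤ a ⬝ᵥ S *ᵥ a + b ⬝ᵥ S *ᵥ b := add_le_add (hS1 a) (hS1 b)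
  by_contra! hge
  have : 1 ≤ ‖μ‖ ^ 2 := one_le_pow₀ hge
  nlinarith [mul_pos (sub_pos.2 hε) hpos]

/-- Comparison of the Gramian of `N` with an approximate solution of its Lyapunov equation. -/
theorem abs_gramian_form_sub_le (hN : Summable fun t : ℕ => N ^ t * Nᵀ ^ t)
    (hNS : N * S * Nᵀ = S - 1 + E) (hE : ∀ x, |x ⬝ᵥ E *ᵥ x| ≤ ε * (x ⬝ᵥ x)) {c : ℝ}
    (hS0 : ∀ x, 0 ≤ x ⬝ᵥ S *ᵥ x) (hSc : ∀ x, x ⬝ᵥ S *ᵥ x ≤ c * (x ⬝ᵥ x)) (x : Fin n → ℝ) :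
    |x ⬝ᵥ S *ᵥ x - x ⬝ᵥ gramian N *ᵥ x| ≤ ε * (x ⬝ᵥ gramian N *ᵥ x) := by
  have hsum := hasSum_gramian_form hN x
  have step : ∀ y, y ⬝ᵥ S *ᵥ y - (y ᵥ* N) ⬝ᵥ S *ᵥ (y ᵥ* N) = y ⬝ᵥ y - y ⬝ᵥ E *ᵥ y := fun y => by
    rw [← dotProduct_mul_transpose_mulVec, hNS, Matrix.add_mulVec, Matrix.sub_mulVec,
      Matrix.one_mulVec, dotProduct_add, dotProduct_sub]
    ring
  have hfin : ∀ T : ℕ, |x ⬝ᵥ S *ᵥ x - (x ᵥ* N ^ T) ⬝ᵥ S *ᵥ (x ᵥ* N ^ T)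
      - ∑ t ∈ Finset.range T, (x ᵥ* N ^ t) ⬝ᵥ (x ᵥ* N ^ t)|
      ≤ ε * ∑ t ∈ Finset.range T, (x ᵥ* N ^ t) ⬝ᵥ (x ᵥ* N ^ t) := by
    intro T
    induction T with
    | zero => simp
    | succ T ih =>
      have h1 := step (x ᵥ* N ^ T)
      rw [Matrix.vecMul_vecMul, ← pow_succ] at h1
      rw [Finset.sum_range_succ]
      have h2 := abs_le.1 (hE (x ᵥ* N ^ T))
      have h3 := abs_le.1 ih
      exact abs_le.2 ⟨by linarith [h2.1, h2.2, h3.1, h3.2], by linarith [h2.1, h2.2, h3.1, h3.2]⟩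
  have htail : Tendsto (fun T : ℕ => (x ᵥ* N ^ T) ⬝ᵥ S *ᵥ (x ᵥ* N ^ T)) atTop (𝓝 0) := by
    refine squeeze_zero (fun T => hS0 _) (fun T => hSc _) ?_
    simpa using hsum.summable.tendsto_atTop_zero.const_mul c
  have hlim := hsum.tendsto_sum_nat
  have := le_of_tendsto_of_tendsto' (((htail.const_sub (x ⬝ᵥ S *ᵥ x)).sub hlim).abs)
    (hlim.const_mul ε) hfin
  simpa using this

/-- The defect of the Lyapunov equation after perturbing the system matrix. -/
theorem abs_lyapunov_defect_le {M Δ : Matrix (Fin n) (Fin n) ℝ} (hS : S.IsSymm)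
    (hS0 : ∀ x, 0 ≤ x ⬝ᵥ S *ᵥ x) (hMS : M * S * Mᵀ = S - 1) {k δ : ℝ}
    (hSk : ∀ x, x ⬝ᵥ S *ᵥ x ≤ k ^ 2 * (x ⬝ᵥ x)) (hδ : spNorm Δ ≤ δ) (x : Fin n → ℝ) :
    |x ⬝ᵥ ((M + Δ) * S * (M + Δ)ᵀ - (S - 1)) *ᵥ x|
      ≤ (2 * k ^ 2 * δ + k ^ 2 * δ ^ 2) * (x ⬝ᵥ x) := by
  have hδ0 : 0 ≤ δ := (spNorm_nonneg Δ).trans hδ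
  have hx := dotProduct_self_nonneg x
  have huu : (x ᵥ* M) ⬝ᵥ S *ᵥ (x ᵥ* M) = x ⬝ᵥ S *ᵥ x - x ⬝ᵥ x := by
    rw [← dotProduct_mul_transpose_mulVec, hMS, Matrix.sub_mulVec, Matrix.one_mulVec,
      dotProduct_sub]
  have hu : (x ᵥ* M) ⬝ᵥ S *ᵥ (x ᵥ* M) ≤ k ^ 2 * (x ⬝ᵥ x) := by
    linarith [hSk x]
  have hv : (x ᵥ* Δ) ⬝ᵥ S *ᵥ (x ᵥ* Δ) ≤ k ^ 2 * δ ^ 2 * (x ⬝ᵥ x) :=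
    calc _ ≤ k ^ 2 * ((x ᵥ* Δ) ⬝ᵥ (x ᵥ* Δ)) := hSk _
      _ ≤ k ^ 2 * (spNorm Δ ^ 2 * (x ⬝ᵥ x)) := by gcongr; exact vecMul_dotProduct_self_le Δ x
      _ ≤ k ^ 2 * (δ ^ 2 * (x ⬝ᵥ x)) := by gcongr; exact spNorm_nonneg Δ
      _ = _ := by ring
  have huv : |(x ᵥ* M) ⬝ᵥ S *ᵥ (x ᵥ* Δ)| ≤ k ^ 2 * δ * (x ⬝ᵥ x) := by
    refine abs_le_of_sq_le_sq ?_ (by positivity)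
    calc _ ≤ _ := sq_dotProduct_mulVec_le hS hS0 _ _
      _ ≤ (k ^ 2 * (x ⬝ᵥ x)) * (k ^ 2 * δ ^ 2 * (x ⬝ᵥ x)) := by gcongr; exact hS0 _
      _ = _ := by ring
  have hexp : x ⬝ᵥ ((M + Δ) * S * (M + Δ)ᵀ - (S - 1)) *ᵥ x
      = 2 * ((x ᵥ* M) ⬝ᵥ S *ᵥ (x ᵥ* Δ)) + (x ᵥ* Δ) ⬝ᵥ S *ᵥ (x ᵥ* Δ) := by
    rw [Matrix.sub_mulVec, dotProduct_sub, dotProduct_mul_transpose_mulVec, Matrix.vecMul_add,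
      Matrix.mulVec_add, add_dotProduct, dotProduct_add, dotProduct_add, huu,
      dotProduct_mulVec_symm hS (x ᵥ* Δ) (x ᵥ* M), Matrix.sub_mulVec, Matrix.one_mulVec,
      dotProduct_sub]
    ring
  rw [hexp]
  have := abs_le.1 huv
  have := hS0 (x ᵥ* Δ)
  exact abs_le.2 ⟨by nlinarith, by nlinarith⟩

end Perturbation

theorem Smat_eq_gramian {n m p : ℕ} (A : Matrix (Fin n) (Fin n) ℝ) (B : Matrix (Fin n) (Fin m) ℝ)
    (C : Matrix (Fin p) (Fin n) ℝ) {γ : ℝ} (hγ : 0 ≤ γ) (K : Matrix (Fin m) (Fin p) ℝ) :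
    Smat A B C γ K = gramian (Real.sqrt γ • Acl A B C K) := by
  refine tsum_congr fun t => ?_
  rw [Matrix.transpose_smul, smul_pow, smul_pow, smul_mul_smul_comm, ← mul_pow,
    Real.mul_self_sqrt hγ]

theorem Pmat_eq_tsum {n m p : ℕ} (A : Matrix (Fin n) (Fin n) ℝ) (B : Matrix (Fin n) (Fin m) ℝ)
    (C : Matrix (Fin p) (Fin n) ℝ) (Q : Matrix (Fin n) (Fin n) ℝ) (R : Matrix (Fin m) (Fin m) ℝ)
    {γ : ℝ} (hγ : 0 ≤ γ) (K : Matrix (Fin m) (Fin p) ℝ) :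
    Pmat A B C Q R γ K = ∑' t : ℕ, (Real.sqrt γ • Acl A B C K)ᵀ ^ t *
      (Q + Cᵀ * Kᵀ * R * K * C) * (Real.sqrt γ • Acl A B C K) ^ t := by
  refine tsum_congr fun t => ?_
  rw [Matrix.transpose_smul, smul_pow, smul_pow, smul_mul_assoc, smul_mul_smul_comm, ← mul_pow,
    Real.mul_self_sqrt hγ]

/-- local Lipschitz continuity of `K ↦ Σ_K(γ)` on `S_γ(ν)`. -/
theorem stmt2
    {n m p : ℕ} (hn : 1 ≤ n) (hm : 1 ≤ m) (hp : 1 ≤ p)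
    (A : Matrix (Fin n) (Fin n) ℝ) (B : Matrix (Fin n) (Fin m) ℝ) (C : Matrix (Fin p) (Fin n) ℝ)
    (Q : Matrix (Fin n) (Fin n) ℝ) (R : Matrix (Fin m) (Fin m) ℝ)
    (hQsymm : Q.IsSymm) (hRsymm : R.IsSymm)
    (ℓ₀ ℓ₁ ψ φ : ℝ) (hℓ₀ : 0 < ℓ₀) (hℓ₀₁ : ℓ₀ ≤ ℓ₁) (hψ : 1 ≤ ψ) (hφ : 1 ≤ φ)
    (hQlb : (Q - ℓ₀ • (1 : Matrix (Fin n) (Fin n) ℝ)).PosSemidef)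
    (hQub : (ℓ₁ • (1 : Matrix (Fin n) (Fin n) ℝ) - Q).PosSemidef)
    (hRlb : (R - ℓ₀ • (1 : Matrix (Fin m) (Fin m) ℝ)).PosSemidef)
    (hRub : (ℓ₁ • (1 : Matrix (Fin m) (Fin m) ℝ) - R).PosSemidef)
    (hB : spNorm B ≤ ψ) (hC : spNorm C ≤ φ)
    (γ : ℝ) (hγ : γ ∈ Set.Ioc (0 : ℝ) 1) (ν : ℝ) (hν : 0 < ν)
    (K K' : Matrix (Fin m) (Fin p) ℝ)
    (hK : inS A B C γ K) (hKν : Jcost A B C Q R γ K ≤ ν)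
    (hKK' : spNorm (K - K') ≤ 1 / (8 * Real.sqrt (ν / ℓ₀) ^ 3 * ψ * φ)) :
    inS A B C γ K' ∧
      spNorm (Smat A B C γ K - Smat A B C γ K') ≤
        6 * Real.sqrt (ν / ℓ₀) ^ 5 * ψ * φ * spNorm (K - K') := by
  obtain ⟨hγ0, hγ1⟩ := hγ
  set κ := Real.sqrt (ν / ℓ₀) with hκ
  set s := Real.sqrt γ with hs
  have hs0 : 0 < s := Real.sqrt_pos.2 hγ0
  have hs1 : s ≤ 1 := Real.sqrt_le_one.2 hγ1
  have hκ2 : κ ^ 2 = ν / ℓ₀ := Real.sq_sqrt (by positivity)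
  set M := s • Acl A B C K with hM
  set Δ := s • (B * (K - K') * C) with hΔdef
  have hN : s • Acl A B C K' = M + Δ := by
    rw [hM, hΔdef, ← smul_add, Acl, Acl, Matrix.mul_sub, Matrix.sub_mul]
    congr 1
    abel
  have hMstable := (sqrt_mul_specRad_lt_one_iff hn (Acl A B C K) hs0).1 hK
  have hMsum := summable_pow_mul_transpose_pow hn hMstable
  set S := gramian M with hSdef
  have hSsymm : S.IsSymm := gramian_isSymm M
  have hS1 : ∀ x, x ⬝ᵥ x ≤ x ⬝ᵥ S *ᵥ x := dotProduct_self_le_gramian_form hMsum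
  have hS0 : ∀ x, 0 ≤ x ⬝ᵥ S *ᵥ x := fun x => (dotProduct_self_nonneg x).trans (hS1 x)
  have hMS : M * S * Mᵀ = S - 1 := mul_gramian_mul_transpose hMsum
  -- The cost bounds the trace of the Gramian.
  have htrace : S.trace ≤ κ ^ 2 := by
    have hR : R.PosSemidef := by
      simpa using hRlb.add (Matrix.PosSemidef.one.smul hℓ₀.le)
    have hW : (Q + Cᵀ * Kᵀ * R * K * C - ℓ₀ • (1 : Matrix (Fin n) (Fin n) ℝ)).PosSemidef := by
      have h1 := hQlb.add (hR.conjTranspose_mul_mul_same (K * C))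
      rw [Matrix.conjTranspose_eq_transpose_of_trivial, Matrix.transpose_mul] at h1
      convert h1 using 1
      simp only [Matrix.mul_assoc]
      abel
    have h1 := mul_trace_gramian_le hMsum (summable_transpose_pow_mul_mul_pow hn hMstable _) hW
    rw [Jcost, Pmat_eq_tsum A B C Q R hγ0.le] at hKν
    rw [hκ2, le_div_iff₀ hℓ₀, mul_comm]
    exact h1.trans hKν
  have hSκ : ∀ x, x ⬝ᵥ S *ᵥ x ≤ κ ^ 2 * (x ⬝ᵥ x) := fun x =>
    (gramian_form_le_trace hMsum x).trans
      (mul_le_mul_of_nonneg_right htrace (dotProduct_self_nonneg x))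
  have hκ1 : 1 ≤ κ := by
    have h1 := (hS1 (Pi.single ⟨0, hn⟩ 1)).trans (hSκ (Pi.single ⟨0, hn⟩ 1))
    rw [dotProduct_single_one, Pi.single_eq_same, mul_one] at h1
    exact (one_le_sq_iff₀ (Real.sqrt_nonneg _)).1 h1
  set d := spNorm (K - K') with hd
  have hd0 : 0 ≤ d := spNorm_nonneg _
  set δ := ψ * φ * d with hδdef
  have hδ0 : 0 ≤ δ := by positivity
  have hΔ : spNorm Δ ≤ δ := by
    rw [hΔdef, spNorm_smul, abs_of_pos hs0]
    calc s * spNorm (B * (K - K') * C) ≤ 1 * (spNorm B * d * spNorm C) := by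
          gcongr
          · exact spNorm_nonneg _
          · exact (spNorm_mul_le _ _).trans
              (mul_le_mul_of_nonneg_right (spNorm_mul_le _ _) (spNorm_nonneg _))
      _ ≤ 1 * (ψ * d * φ) := by gcongr; exact spNorm_nonneg _
      _ = δ := by rw [hδdef]; ring
  have hδκ : 8 * κ ^ 3 * δ ≤ 1 := by
    rw [le_div_iff₀ (by positivity)] at hKK'
    linarith
  set ε := 2 * κ ^ 2 * δ + κ ^ 2 * δ ^ 2 with hεdef
  have hδ8 : 8 * δ ≤ 1 := by nlinarith [one_le_pow₀ hκ1 (n := 3)]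
  have hε : ε ≤ 17 / 8 * (κ ^ 2 * δ) := by nlinarith [mul_nonneg (sq_nonneg κ) hδ0]
  have hκδ : 8 * (κ ^ 2 * δ) ≤ 1 := by
    have : κ ^ 2 ≤ κ ^ 3 := pow_le_pow_right₀ hκ1 (by norm_num)
    nlinarith
  have hε1 : ε ≤ 17 / 64 := by linarith
  have hε0 : 0 ≤ ε := by positivity
  have hE := abs_lyapunov_defect_le hSsymm hS0 hMS hSκ hΔ
  have hNS : (M + Δ) * S * (M + Δ)ᵀ = S - 1 + ((M + Δ) * S * (M + Δ)ᵀ - (S - 1)) := by abel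
  have hNstable := norm_lt_one_of_lyapunov hSsymm hS1 hNS (by linarith) hE
  have hNsum := summable_pow_mul_transpose_pow hn hNstable
  refine ⟨(sqrt_mul_specRad_lt_one_iff hn _ hs0).2 (hN.symm ▸ hNstable), ?_⟩
  rw [Smat_eq_gramian A B C hγ0.le, Smat_eq_gramian A B C hγ0.le, ← hs, hN]
  refine (spNorm_le_of_abs_dotProduct_le (c := 3 * κ ^ 4 * δ)
    (hSsymm.sub (gramian_isSymm _)) (by positivity) fun x => ?_).trans ?_
  · have h1 := abs_gramian_form_sub_le hNsum hNS hE hS0 hSκ x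
    have hx := dotProduct_self_nonneg x
    rw [Matrix.sub_mulVec, dotProduct_sub]
    set g := x ⬝ᵥ gramian (M + Δ) *ᵥ x
    have hg0 : 0 ≤ g := hx.trans (dotProduct_self_le_gramian_form hNsum x)
    have h2 := (abs_le.1 h1).1
    have hg : 47 / 64 * g ≤ κ ^ 2 * (x ⬝ᵥ x) := by
      nlinarith [hSκ x, mul_le_mul_of_nonneg_right hε1 hg0]
    calc _ ≤ ε * g := h1
      _ ≤ 17 / 8 * (κ ^ 2 * δ) * (64 / 47 * (κ ^ 2 * (x ⬝ᵥ x))) := by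
        gcongr
        linarith
      _ = 136 / 47 * (κ ^ 4 * δ * (x ⬝ᵥ x)) := by ring
      _ ≤ 3 * (κ ^ 4 * δ * (x ⬝ᵥ x)) := by gcongr; norm_num
      _ = _ := by ring
  · calc 3 * κ ^ 4 * δ ≤ 6 * κ ^ 5 * δ := by
          gcongr
          · norm_num
          · norm_num
      _ = _ := by rw [hδdef]; ring
end

section
/- Let γ ∈ (0,1], ν > 0, K ∈ S_γ(ν), and let K' ∈ ℝ^{m×p} satisfy ‖K − K'‖ ≤ D where D = 1/(8κ³ψφ). Then K' ∈ S_γ and |J_γ(K) − J_γ(K')| ≤ G·‖K − K'‖, where G = 16κ⁹ℓ₁ψφ. In other words, J_γ is locally (G, D)-Lipschitz over S_γ(ν). -/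
open Matrix

section Lyapunov

open Filter Topology
open scoped Matrix.Norms.L2Operator

theorem Matrix.PosSemidef.isSymm {ι : Type*} {X : Matrix ι ι ℝ} (hX : X.PosSemidef) : X.IsSymm := by
  simpa [IsHermitian, IsSymm] using hX.1

variable {ι κ : Type*} [Fintype ι] [Fintype κ]

theorem Matrix.PosSemidef.congr_transpose {X : Matrix ι ι ℝ} (hX : X.PosSemidef)
    (Y : Matrix κ ι ℝ) : (Y * X * Yᵀ).PosSemidef := by
  simpa using hX.mul_mul_conjTranspose_same Y

theorem Matrix.PosSemidef.dotProduct_real {X : Matrix ι ι ℝ} (hX : X.PosSemidef) (v : ι → ℝ) :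
    0 ≤ v ⬝ᵥ (X *ᵥ v) := by simpa using hX.dotProduct_mulVec_nonneg v

theorem Matrix.IsSymm.dotProduct_mulVec_comm {X : Matrix ι ι ℝ} (hX : X.IsSymm) (v w : ι → ℝ) :
    v ⬝ᵥ (X *ᵥ w) = w ⬝ᵥ (X *ᵥ v) := by
  rw [dotProduct_mulVec, ← mulVec_transpose, hX.eq, dotProduct_comm]

theorem dotProduct_congr_transpose (X : Matrix ι ι ℝ) (Y : Matrix κ ι ℝ) (v : κ → ℝ) :
    v ⬝ᵥ ((Y * X * Yᵀ) *ᵥ v) = (v ᵥ* Y) ⬝ᵥ (X *ᵥ (v ᵥ* Y)) := by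
  rw [← mulVec_mulVec, mulVec_transpose, ← mulVec_mulVec, dotProduct_mulVec]

/-- Weighted Young inequality for congruences of a positive semidefinite matrix. -/
theorem posSemidef_young {S : Matrix ι ι ℝ} (hS : S.PosSemidef) (X Y : Matrix κ ι ℝ) {d : ℝ}
    (hd : 0 < d) :
    (d • (X * S * Xᵀ) + d⁻¹ • (Y * S * Yᵀ) + (X * S * Yᵀ + Y * S * Xᵀ)).PosSemidef := by
  convert (hS.congr_transpose (d • X + Y)).smul (inv_pos.2 hd).le using 1
  simp only [transpose_add, transpose_smul, Matrix.add_mul, Matrix.mul_add, Matrix.smul_mul, Matrix.mul_smul, smul_add,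
    smul_smul]
  rw [inv_mul_cancel_left₀ hd.ne', inv_mul_cancel₀ hd.ne']
  module

variable [DecidableEq ι] [DecidableEq κ]

/-- A real matrix whose complex eigenvalues lie in the open unit disc has summable powers. -/
theorem summable_norm_pow_of_spectrum {M : Matrix ι ι ℝ}
    (hM : ∀ μ ∈ spectrum ℂ (M.map (algebraMap ℝ ℂ)), ‖μ‖ < 1) :
    Summable fun t : ℕ => ‖M ^ t‖ := by
  cases isEmpty_or_nonempty ι
  · have h : ∀ t : ℕ, M ^ t = 0 := fun t => Subsingleton.elim _ _
    simp only [h, norm_zero]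
    exact summable_zero
  set N : Matrix ι ι ℂ := M.map (algebraMap ℝ ℂ) with hN
  have hr : spectralRadius ℂ N < (1 : NNReal) :=
    spectrum.spectralRadius_lt_of_forall_lt N fun μ hμ => by
      have := hM μ hμ
      exact_mod_cast this
  obtain ⟨r, hρr, hr1⟩ := exists_between hr
  have hev := (spectrum.pow_nnnorm_pow_one_div_tendsto_nhds_spectralRadius N).eventually_lt_const hρr
  lift r to NNReal using (hr1.trans ENNReal.coe_lt_top).ne
  have hr1' : (r : ℝ) < 1 := by exact_mod_cast hr1
  have hbound : ∀ᶠ t : ℕ in atTop, ‖N ^ t‖ ≤ (r : ℝ) ^ t := by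
    filter_upwards [hev, eventually_gt_atTop 0] with t ht ht0
    have ht' : (0 : ℝ) < t := by exact_mod_cast ht0
    have h1 := ENNReal.rpow_le_rpow ht.le ht'.le
    rw [← ENNReal.rpow_mul, one_div_mul_cancel ht'.ne', ENNReal.rpow_one,
      ENNReal.rpow_natCast] at h1
    exact_mod_cast h1
  let re : Matrix ι ι ℂ →ₗ[ℝ] Matrix ι ι ℝ := Complex.reLm.mapMatrix
  have hre : ∀ t : ℕ, LinearMap.toContinuousLinearMap re (N ^ t) = M ^ t := by
    intro t
    have : N ^ t = (M ^ t).map (algebraMap ℝ ℂ) :=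
      (map_pow ((algebraMap ℝ ℂ).mapMatrix) M t).symm
    rw [this]
    ext i j
    simp [re]
  refine Summable.of_norm_bounded_eventually_nat
    (g := fun t => ‖LinearMap.toContinuousLinearMap re‖ * (r : ℝ) ^ t)
    ((summable_geometric_of_lt_one r.2 hr1').mul_left _) ?_
  filter_upwards [hbound] with t ht
  rw [norm_norm, ← hre]
  exact (ContinuousLinearMap.le_opNorm _ _).trans (by gcongr)

theorem tendsto_pow_zero_of_summable {N : Matrix ι ι ℝ} (hN : Summable fun t : ℕ => ‖N ^ t‖) :
    Tendsto (fun t : ℕ => N ^ t) atTop (𝓝 0) :=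
  tendsto_zero_iff_norm_tendsto_zero.2 hN.tendsto_atTop_zero

theorem norm_transpose_real (N : Matrix ι κ ℝ) : ‖Nᵀ‖ = ‖N‖ := by
  rw [← conjTranspose_eq_transpose_of_trivial, l2_opNorm_conjTranspose]

/-- The Lyapunov series solves the Lyapunov equation. -/
theorem lyapunov_tsum_eq {N : Matrix ι ι ℝ} (hN : Summable fun t : ℕ => ‖N ^ t‖)
    (F : Matrix ι ι ℝ) :
    ∑' t : ℕ, N ^ t * F * Nᵀ ^ t = F + N * (∑' t : ℕ, N ^ t * F * Nᵀ ^ t) * Nᵀ := by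
  have hsum : Summable fun t : ℕ => N ^ t * F * Nᵀ ^ t := by
    refine Summable.of_norm_bounded_eventually_nat (g := fun t => ‖N ^ t‖ * ‖F‖)
      (hN.mul_right _) ?_
    filter_upwards [hN.tendsto_atTop_zero.eventually_le_const zero_lt_one] with t ht
    refine (norm_mul_le _ _).trans ?_
    have h1 : ‖Nᵀ ^ t‖ ≤ 1 := by rwa [← transpose_pow, norm_transpose_real]
    calc _ ≤ ‖N ^ t * F‖ * 1 := by gcongr
      _ ≤ _ := by rw [mul_one]; exact norm_mul_le _ _
  conv_lhs => rw [hsum.tsum_eq_zero_add]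
  rw [← hsum.tsum_mul_left, ← (hsum.mul_left N).tsum_mul_right]
  simp only [pow_zero, one_mul, mul_one]
  congr 2
  ext1 t
  rw [pow_succ' N, pow_succ Nᵀ]
  simp only [Matrix.mul_assoc]

/-- Monotonicity of the discrete Lyapunov operator of a stable matrix. -/
theorem posSemidef_of_lyapunov {N X : Matrix ι ι ℝ}
    (hN : Tendsto (fun t : ℕ => N ^ t) atTop (𝓝 0)) (hX : X.IsSymm)
    (h : (X - N * X * Nᵀ).PosSemidef) : X.PosSemidef := by
  have hstep : ∀ t : ℕ, (X - N ^ t * X * (N ^ t)ᵀ).PosSemidef := by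
    intro t
    induction t with
    | zero => simpa using PosSemidef.zero
    | succ t ih =>
      convert ih.add (h.congr_transpose (N ^ t)) using 1
      rw [pow_succ, transpose_mul]
      noncomm_ring
  refine .of_dotProduct_mulVec_nonneg (by simpa [IsHermitian] using hX.eq) fun v => ?_
  have hlim : Tendsto (fun t : ℕ => star v ⬝ᵥ ((X - N ^ t * X * (N ^ t)ᵀ) *ᵥ v)) atTop
      (𝓝 (star v ⬝ᵥ ((X - 0 * X * 0ᵀ) *ᵥ v))) := by
    have hc : Continuous fun Z : Matrix ι ι ℝ => star v ⬝ᵥ ((X - Z * X * Zᵀ) *ᵥ v) := by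
      fun_prop
    exact (hc.tendsto 0).comp hN
  simp only [zero_mul, sub_zero] at hlim
  exact ge_of_tendsto' hlim fun t => (hstep t).dotProduct_mulVec_nonneg v

/-- Lyapunov's criterion: a strict Lyapunov inequality forces the spectrum into the unit disc. -/
theorem norm_lt_one_of_lyapunov_s4 {N S : Matrix ι ι ℝ} (hS : S.PosSemidef) {c : ℝ} (hc : 0 < c)
    (h : (S - N * S * Nᵀ - c • (1 : Matrix ι ι ℝ)).PosSemidef) :
    ∀ μ ∈ spectrum ℂ (N.map (algebraMap ℝ ℂ)), ‖μ‖ < 1 := by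
  intro μ hμ
  rw [spectrum.mem_iff, isUnit_iff_isUnit_det, isUnit_iff_ne_zero, not_not,
    ← exists_vecMul_eq_zero_iff] at hμ
  obtain ⟨v, hv, hvμ⟩ := hμ
  rw [vecMul_sub, sub_eq_zero, Algebra.algebraMap_eq_smul_one, vecMul_smul, vecMul_one] at hvμ
  set x : ι → ℝ := fun i => (v i).re
  set y : ι → ℝ := fun i => (v i).im
  have hx : x ᵥ* N = μ.re • x - μ.im • y := by
    ext i
    have := congrArg Complex.re (congrFun hvμ i)
    simp [vecMul, dotProduct] at this
    simp [vecMul, dotProduct, x, y, this]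
  have hy : y ᵥ* N = μ.re • y + μ.im • x := by
    ext i
    have := congrArg Complex.im (congrFun hvμ i)
    simp [vecMul, dotProduct] at this
    simp [vecMul, dotProduct, x, y, this]
  have hsymm := hS.isSymm
  have hqx := h.dotProduct_real x
  have hqy := h.dotProduct_real y
  simp only [sub_mulVec, dotProduct_sub, dotProduct_congr_transpose, hx, hy, smul_mulVec,
    one_mulVec, dotProduct_smul, mulVec_sub, mulVec_add, mulVec_smul, sub_dotProduct,
    add_dotProduct, dotProduct_add, smul_dotProduct, smul_eq_mul] at hqx hqy
  rw [hsymm.dotProduct_mulVec_comm y x] at hqx hqy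
  have hpos : 0 < x ⬝ᵥ x + y ⬝ᵥ y := by
    have h0x : 0 ≤ x ⬝ᵥ x := by simpa using dotProduct_star_self_nonneg x
    have h0y : 0 ≤ y ⬝ᵥ y := by simpa using dotProduct_star_self_nonneg y
    by_contra hle
    have hx0 : x = 0 := dotProduct_self_eq_zero.1 (by linarith)
    have hy0 : y = 0 := dotProduct_self_eq_zero.1 (by linarith)
    exact hv (funext fun i => Complex.ext (congrFun hx0 i) (congrFun hy0 i))
  have h0 : 0 ≤ x ⬝ᵥ (S *ᵥ x) + y ⬝ᵥ (S *ᵥ y) :=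
    add_nonneg (hS.dotProduct_real x) (hS.dotProduct_real y)
  by_contra hμ1
  have hsq : 1 ≤ μ.re * μ.re + μ.im * μ.im := by
    rw [← Complex.normSq_apply, ← Complex.sq_norm]
    nlinarith [not_lt.1 hμ1]
  nlinarith [mul_pos hc hpos, mul_nonneg (sub_nonneg.2 hsq) h0]

theorem posSemidef_trace_mul_nonneg {X Y : Matrix ι ι ℝ} (hX : X.PosSemidef)
    (hY : Y.PosSemidef) : 0 ≤ (X * Y).trace := by
  obtain ⟨L, rfl⟩ : ∃ L : Matrix ι ι ℝ, X = Lᵀ * L := by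
    open scoped MatrixOrder in
    obtain ⟨L, hL⟩ := CStarAlgebra.nonneg_iff_eq_star_mul_self.1 hX.nonneg
    exact ⟨L, by simpa [star_eq_conjTranspose] using hL⟩
  rw [Matrix.mul_assoc, Matrix.trace_mul_comm]
  exact (hY.congr_transpose L).trace_nonneg

theorem posSemidef_smul_one_of_bound {X : Matrix ι ι ℝ} (hX : X.IsSymm) {c : ℝ}
    (h : ∀ v, v ⬝ᵥ (X *ᵥ v) ≤ c * (v ⬝ᵥ v)) : (c • (1 : Matrix ι ι ℝ) - X).PosSemidef := by
  refine .of_dotProduct_mulVec_nonneg ?_ fun v => ?_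
  · simp [IsHermitian, hX.eq]
  · simpa [sub_mulVec, smul_mulVec] using h v

theorem posSemidef_trace_smul_one_sub {X : Matrix ι ι ℝ} (hX : X.PosSemidef) :
    (X.trace • (1 : Matrix ι ι ℝ) - X).PosSemidef := by
  refine posSemidef_smul_one_of_bound hX.isSymm fun v => ?_
  have hvv : ((v ⬝ᵥ v) • (1 : Matrix ι ι ℝ) - vecMulVec v v).PosSemidef := by
    refine posSemidef_smul_one_of_bound (transpose_vecMulVec v v) fun w => ?_
    rw [vecMulVec_mulVec, dotProduct_smul, MulOpposite.smul_eq_mul_unop, MulOpposite.unop_op,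
      dotProduct_comm w v]
    simpa [dotProduct, pow_two] using Finset.sum_mul_sq_le_sq_mul_sq Finset.univ v w
  have := posSemidef_trace_mul_nonneg hX hvv
  rw [mul_sub, trace_sub, mul_smul_comm, mul_one, trace_smul, mul_vecMulVec, trace_vecMulVec,
    dotProduct_comm (X *ᵥ v), smul_eq_mul] at this
  linarith

theorem posSemidef_sq_smul_one_sub {X : Matrix ι κ ℝ} {d : ℝ} (hX : ‖X‖ ≤ d) :
    (d ^ 2 • (1 : Matrix ι ι ℝ) - X * Xᵀ).PosSemidef := by
  refine posSemidef_smul_one_of_bound (by simp [IsSymm]) fun v => ?_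
  have h := l2_opNorm_mulVec Xᵀ (WithLp.toLp 2 v)
  rw [norm_transpose_real] at h
  have h2 := pow_le_pow_left₀ (norm_nonneg _)
    (h.trans (mul_le_mul_of_nonneg_right hX (norm_nonneg _))) 2
  rw [mul_pow, EuclideanSpace.real_norm_sq_eq, EuclideanSpace.real_norm_sq_eq] at h2
  rw [← mulVec_mulVec, dotProduct_mulVec, ← mulVec_transpose]
  simpa [dotProduct, pow_two] using h2

/-- The Lyapunov defect `E` created by perturbing the closed-loop matrix satisfies `±E ⪯ e I`. -/
theorem lyapunov_perturbation {M Δ S : Matrix ι ι ℝ} {d k : ℝ} (hd : 0 < d) (hS : S.PosSemidef)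
    (hSM : S = 1 + M * S * Mᵀ) (hk : S.trace ≤ k) (hΔ : ‖Δ‖ ≤ d) :
    ((d * (2 + d) * k) • (1 : Matrix ι ι ℝ) -
      ((M + Δ) * S * (M + Δ)ᵀ - (S - 1))).PosSemidef ∧
    ((d * (2 + d) * k) • (1 : Matrix ι ι ℝ) +
      ((M + Δ) * S * (M + Δ)ᵀ - (S - 1))).PosSemidef := by
  have hk0 : 0 ≤ k := hS.trace_nonneg.trans hk
  have hSk : (k • (1 : Matrix ι ι ℝ) - S).PosSemidef := by
    convert (posSemidef_trace_smul_one_sub hS).add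
      (PosSemidef.one.smul (sub_nonneg.2 hk)) using 1
    module
  have hM : (k • (1 : Matrix ι ι ℝ) - M * S * Mᵀ).PosSemidef := by
    convert hSk.add PosSemidef.one using 1
    rw [eq_sub_of_add_eq' hSM.symm]
    module
  have hΔS : ((k * d ^ 2) • (1 : Matrix ι ι ℝ) - Δ * S * Δᵀ).PosSemidef := by
    convert (hSk.congr_transpose Δ).add ((posSemidef_sq_smul_one_sub hΔ).smul hk0) using 1
    simp only [Matrix.mul_sub, Matrix.sub_mul, Matrix.mul_smul, Matrix.smul_mul, Matrix.mul_one]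
    module
  have hE : (M + Δ) * S * (M + Δ)ᵀ - (S - 1) =
      M * S * Δᵀ + Δ * S * Mᵀ + Δ * S * Δᵀ := by
    rw [sub_eq_of_eq_add' hSM]
    simp only [transpose_add, Matrix.add_mul, Matrix.mul_add]
    abel
  rw [hE]
  constructor
  · convert (((posSemidef_young hS M (-Δ) hd).add (hM.smul hd.le)).add
      (hΔS.smul (inv_pos.2 hd).le)).add hΔS using 1
    simp only [transpose_neg, Matrix.neg_mul, Matrix.mul_neg, neg_neg]
    match_scalars <;> field_simp <;> ring
  · convert (((posSemidef_young hS M Δ hd).add (hM.smul hd.le)).add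
      (hΔS.smul (inv_pos.2 hd).le)).add
      ((hS.congr_transpose Δ).add (PosSemidef.one.smul (by positivity : 0 ≤ k * d ^ 2))) using 1
    match_scalars <;> field_simp <;> ring

/-- The perturbation of the stage cost `Q + XᵀRX` is dominated by `dXᵀRX + (d + d²)ℓ I`. -/
theorem stageCost_perturbation {R : Matrix κ κ ℝ} {X Y : Matrix κ ι ℝ} {d l : ℝ} (hd : 0 < d)
    (hl : 0 ≤ l) (hR : R.PosSemidef) (hRl : (l • (1 : Matrix κ κ ℝ) - R).PosSemidef)
    (hY : ‖Y‖ ≤ d) :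
    (d • (Xᵀ * R * X) + ((d + d ^ 2) * l) • (1 : Matrix ι ι ℝ) -
      ((X + Y)ᵀ * R * (X + Y) - Xᵀ * R * X)).PosSemidef ∧
    (d • (Xᵀ * R * X) + ((d + d ^ 2) * l) • (1 : Matrix ι ι ℝ) +
      ((X + Y)ᵀ * R * (X + Y) - Xᵀ * R * X)).PosSemidef := by
  have hYR : ((l * d ^ 2) • (1 : Matrix ι ι ℝ) - Yᵀ * R * Y).PosSemidef := by
    have h1 := hRl.congr_transpose Yᵀ
    have h2 := (posSemidef_sq_smul_one_sub ((norm_transpose_real Y).trans_le hY)).smul hl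
    rw [transpose_transpose] at h1 h2
    convert h1.add h2 using 1
    simp only [Matrix.mul_sub, Matrix.sub_mul, Matrix.mul_smul, Matrix.smul_mul, Matrix.mul_one]
    module
  have hE : (X + Y)ᵀ * R * (X + Y) - Xᵀ * R * X =
      Xᵀ * R * Y + Yᵀ * R * X + Yᵀ * R * Y := by
    simp only [transpose_add, Matrix.add_mul, Matrix.mul_add]
    abel
  rw [hE]
  constructor
  · convert ((posSemidef_young hR Xᵀ (-Yᵀ) hd).add (hYR.smul (inv_pos.2 hd).le)).add hYR using 1
    simp only [transpose_neg, transpose_transpose, Matrix.neg_mul, Matrix.mul_neg, neg_neg]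
    match_scalars <;> field_simp <;> ring
  · convert ((posSemidef_young hR Xᵀ Yᵀ hd).add (hYR.smul (inv_pos.2 hd).le)).add
      ((hR.congr_transpose Yᵀ).add (PosSemidef.one.smul (by positivity : 0 ≤ l * d ^ 2))) using 1
    simp only [transpose_transpose]
    match_scalars <;> field_simp <;> ring

/-- If `S` satisfies a perturbed Lyapunov equation for the stable matrix `N` and `S'` the exact
one, then `S' ⪯ 2S` and `|tr (W (S' - S))| ≤ 2e tr (W S)`. -/
theorem lyapunov_comparison {N S S' W : Matrix ι ι ℝ} {e : ℝ}
    (hN : Tendsto (fun t : ℕ => N ^ t) atTop (𝓝 0)) (he0 : 0 ≤ e) (he : e ≤ 1 / 2)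
    (hS : S.IsSymm) (hS' : S'.IsSymm) (hSN : S' = 1 + N * S' * Nᵀ) (hW : W.PosSemidef)
    (h1 : (e • (1 : Matrix ι ι ℝ) - (N * S * Nᵀ - (S - 1))).PosSemidef)
    (h2 : (e • (1 : Matrix ι ι ℝ) + (N * S * Nᵀ - (S - 1))).PosSemidef) :
    ((2 : ℝ) • S - S').PosSemidef ∧ |(W * S).trace - (W * S').trace| ≤ 2 * e * (W * S).trace := by
  have hsub : N * S' * Nᵀ = S' - 1 := (sub_eq_of_eq_add' hSN).symm
  have hcmp : ((2 : ℝ) • S - S').PosSemidef := by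
    refine posSemidef_of_lyapunov hN ((hS.smul _).sub hS') ?_
    convert (h1.smul (zero_le_two (α := ℝ))).add (PosSemidef.one.smul (by linarith : 0 ≤ 1 - 2 * e)) using 1
    simp only [Matrix.mul_sub, Matrix.sub_mul, Matrix.mul_smul, Matrix.smul_mul, hsub]
    module
  have hup : (e • S' - (S' - S)).PosSemidef := by
    refine posSemidef_of_lyapunov hN ((hS'.smul _).sub (hS'.sub hS)) ?_
    convert h1 using 1
    simp only [Matrix.mul_sub, Matrix.sub_mul, Matrix.mul_smul, Matrix.smul_mul, hsub]
    module
  have hlo : (e • S' + (S' - S)).PosSemidef := by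
    refine posSemidef_of_lyapunov hN ((hS'.smul _).add (hS'.sub hS)) ?_
    convert h2 using 1
    simp only [Matrix.mul_sub, Matrix.sub_mul, Matrix.mul_add, Matrix.add_mul, Matrix.mul_smul,
      Matrix.smul_mul, hsub]
    module
  refine ⟨hcmp, ?_⟩
  have t0 := posSemidef_trace_mul_nonneg hW hcmp
  have t1 := posSemidef_trace_mul_nonneg hW hup
  have t2 := posSemidef_trace_mul_nonneg hW hlo
  simp only [Matrix.mul_sub, Matrix.mul_add, Matrix.mul_smul, trace_sub, trace_add, trace_smul,
    smul_eq_mul] at t0 t1 t2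
  rw [abs_le]
  constructor <;> nlinarith [mul_nonneg he0 t0]

end Lyapunov

section ClosedLoop

open Filter Topology
open scoped Matrix.Norms.L2Operator

variable {n m p : ℕ}

theorem spNorm_eq_norm {a b : ℕ} (M : Matrix (Fin a) (Fin b) ℝ) : spNorm M = ‖M‖ := rfl

/-- Membership in `S_γ` says that the scaled closed-loop matrix is Schur stable. -/
theorem inS_iff_spectrum (hn : 1 ≤ n) (A : Matrix (Fin n) (Fin n) ℝ)
    (B : Matrix (Fin n) (Fin m) ℝ) (C : Matrix (Fin p) (Fin n) ℝ) {γ : ℝ} (hγ : 0 < γ)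
    (K : Matrix (Fin m) (Fin p) ℝ) :
    inS A B C γ K ↔
      ∀ μ ∈ spectrum ℂ ((Real.sqrt γ • Acl A B C K).map (algebraMap ℝ ℂ)), ‖μ‖ < 1 := by
  have : NeZero n := ⟨by omega⟩
  have hs : 0 < Real.sqrt γ := Real.sqrt_pos.2 hγ
  have hsC : (Real.sqrt γ : ℂ) ≠ 0 := by exact_mod_cast hs.ne'
  set X : Matrix (Fin n) (Fin n) ℂ := (Acl A B C K).map (algebraMap ℝ ℂ) with hX
  have hmap : (Real.sqrt γ • Acl A B C K).map (algebraMap ℝ ℂ) = (Real.sqrt γ : ℂ) • X := by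
    ext i j
    simp [X]
  have hne : (spectrum ℂ X).Nonempty := spectrum.nonempty X
  have himage : {r : ℝ | ∃ μ ∈ spectrum ℂ X, r = ‖μ‖} = norm '' spectrum ℂ X := by
    ext r
    simp [eq_comm]
  rw [hmap, spectrum.smul_eq_smul _ _ hne, inS, specRad, himage, mul_comm, ← lt_div_iff₀ hs,
    (X.finite_spectrum.image _).csSup_lt_iff (hne.image _)]
  simp only [Set.forall_mem_image, Set.mem_smul_set, forall_exists_index, and_imp,
    forall_apply_eq_imp_iff₂, smul_eq_mul, norm_mul, Complex.norm_real, Real.norm_eq_abs,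
    abs_of_pos hs, lt_div_iff₀' hs]

/-- The Lyapunov series with unit forcing, in the scaled closed-loop matrix. -/
theorem exists_gramian {M : Matrix (Fin n) (Fin n) ℝ} (hM : Summable fun t : ℕ => ‖M ^ t‖) :
    ∃ S : Matrix (Fin n) (Fin n) ℝ, S.PosSemidef ∧ S = 1 + M * S * Mᵀ := by
  have hS := lyapunov_tsum_eq hM 1
  set S := ∑' t : ℕ, M ^ t * 1 * Mᵀ ^ t with hSdef
  have hsymm : S.IsSymm := by
    rw [IsSymm, hSdef, transpose_tsum]
    simp
  refine ⟨S, posSemidef_of_lyapunov (tendsto_pow_zero_of_summable hM) hsymm ?_, hS⟩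
  rw [sub_eq_of_eq_add hS]
  exact PosSemidef.one

/-- The cost is `tr ((Q + CᵀKᵀRKC) S)` for the solution `S` of the dual Lyapunov equation. -/
theorem Jcost_eq_trace (A : Matrix (Fin n) (Fin n) ℝ) (B : Matrix (Fin n) (Fin m) ℝ)
    (C : Matrix (Fin p) (Fin n) ℝ) (Q : Matrix (Fin n) (Fin n) ℝ) (R : Matrix (Fin m) (Fin m) ℝ)
    {γ : ℝ} (hγ : 0 ≤ γ) (K : Matrix (Fin m) (Fin p) ℝ)
    (hM : Summable fun t : ℕ => ‖(Real.sqrt γ • Acl A B C K) ^ t‖)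
    {S : Matrix (Fin n) (Fin n) ℝ}
    (hS : S = 1 + (Real.sqrt γ • Acl A B C K) * S * (Real.sqrt γ • Acl A B C K)ᵀ) :
    Jcost A B C Q R γ K = ((Q + (K * C)ᵀ * R * (K * C)) * S).trace := by
  set M := Real.sqrt γ • Acl A B C K with hMdef
  set W := Q + (K * C)ᵀ * R * (K * C) with hW
  have hP : Pmat A B C Q R γ K = ∑' t : ℕ, Mᵀ ^ t * W * Mᵀᵀ ^ t := by
    rw [Pmat]
    congr 1
    ext1 t
    have hW' : Q + Cᵀ * Kᵀ * R * K * C = W := by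
      rw [hW, transpose_mul]
      simp only [Matrix.mul_assoc]
    rw [hW', transpose_transpose, hMdef, transpose_smul, smul_pow, smul_pow, Matrix.smul_mul,
      Matrix.smul_mul, Matrix.mul_smul, smul_smul, ← mul_pow, Real.mul_self_sqrt hγ]
  have hMt : Summable fun t : ℕ => ‖Mᵀ ^ t‖ := by
    simpa only [← transpose_pow, norm_transpose_real] using hM
  have hfix := lyapunov_tsum_eq hMt W
  rw [← hP, transpose_transpose] at hfix
  have h1 : M * S * Mᵀ = S - 1 := (sub_eq_of_eq_add' hS).symm
  have hcycle : (Mᵀ * Pmat A B C Q R γ K * M * S).trace =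
      (Pmat A B C Q R γ K * (M * S * Mᵀ)).trace := by
    rw [Matrix.mul_assoc, Matrix.mul_assoc, Matrix.trace_mul_comm]
    simp only [Matrix.mul_assoc]
  rw [Jcost, ← sub_eq_of_eq_add hfix, Matrix.sub_mul, trace_sub, hcycle, h1, Matrix.mul_sub,
    trace_sub, Matrix.mul_one, sub_sub_cancel]

theorem norm_gain_perturbation_le {C : Matrix (Fin p) (Fin n) ℝ} {ψ φ : ℝ} (hψ : 1 ≤ ψ)
    (hφ : 0 ≤ φ) (hC : spNorm C ≤ φ) (K K' : Matrix (Fin m) (Fin p) ℝ) :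
    ‖(K' - K) * C‖ ≤ ψ * φ * spNorm (K - K') := by
  rw [spNorm_eq_norm] at hC ⊢
  calc _ ≤ ‖K' - K‖ * ‖C‖ := l2_opNorm_mul _ _
    _ ≤ ‖K' - K‖ * φ := by gcongr
    _ = 1 * φ * ‖K - K'‖ := by rw [norm_sub_rev]; ring
    _ ≤ _ := by gcongr

theorem norm_closedLoop_perturbation_le {B : Matrix (Fin n) (Fin m) ℝ}
    {C : Matrix (Fin p) (Fin n) ℝ} {ψ φ γ : ℝ} (hγ : γ ≤ 1) (hB : spNorm B ≤ ψ)
    (hC : spNorm C ≤ φ) (K K' : Matrix (Fin m) (Fin p) ℝ) :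
    ‖Real.sqrt γ • (B * (K - K') * C)‖ ≤ ψ * φ * spNorm (K - K') := by
  rw [spNorm_eq_norm] at hB hC ⊢
  rw [norm_smul, Real.norm_of_nonneg (Real.sqrt_nonneg _)]
  have hψ : 0 ≤ ψ := (norm_nonneg _).trans hB
  calc _ ≤ 1 * (‖B‖ * ‖K - K'‖ * ‖C‖) := by
        gcongr
        · exact Real.sqrt_le_one.2 hγ
        · exact (l2_opNorm_mul _ _).trans (by gcongr; exact l2_opNorm_mul _ _)
    _ ≤ 1 * (ψ * ‖K - K'‖ * φ) := by gcongr
    _ = _ := by ring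

theorem spNorm_nonneg_s4 (K : Matrix (Fin m) (Fin p) ℝ) : 0 ≤ spNorm K := norm_nonneg K

theorem eq_zero_of_spNorm_eq_zero {K : Matrix (Fin m) (Fin p) ℝ} (hK : spNorm K = 0) : K = 0 :=
  norm_eq_zero.1 hK

end ClosedLoop

/-- `J_γ` is locally `(G, D)`-Lipschitz over `S_γ(ν)` with
`G = 16κ⁹ℓ₁ψφ` and `D = 1/(8κ³ψφ)`. -/
theorem stmt4
    {n m p : ℕ} (hn : 1 ≤ n) (hm : 1 ≤ m) (hp : 1 ≤ p)
    (A : Matrix (Fin n) (Fin n) ℝ) (B : Matrix (Fin n) (Fin m) ℝ) (C : Matrix (Fin p) (Fin n) ℝ)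
    (Q : Matrix (Fin n) (Fin n) ℝ) (R : Matrix (Fin m) (Fin m) ℝ)
    (hQsymm : Q.IsSymm) (hRsymm : R.IsSymm)
    (ℓ₀ ℓ₁ ψ φ : ℝ) (hℓ₀ : 0 < ℓ₀) (hℓ₀₁ : ℓ₀ ≤ ℓ₁) (hψ : 1 ≤ ψ) (hφ : 1 ≤ φ)
    (hQlb : (Q - ℓ₀ • (1 : Matrix (Fin n) (Fin n) ℝ)).PosSemidef)
    (hQub : (ℓ₁ • (1 : Matrix (Fin n) (Fin n) ℝ) - Q).PosSemidef)
    (hRlb : (R - ℓ₀ • (1 : Matrix (Fin m) (Fin m) ℝ)).PosSemidef)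
    (hRub : (ℓ₁ • (1 : Matrix (Fin m) (Fin m) ℝ) - R).PosSemidef)
    (hB : spNorm B ≤ ψ) (hC : spNorm C ≤ φ)
    (γ : ℝ) (hγ : γ ∈ Set.Ioc (0 : ℝ) 1) (ν : ℝ) (hν : 0 < ν)
    (K K' : Matrix (Fin m) (Fin p) ℝ)
    (hK : inS A B C γ K) (hKν : Jcost A B C Q R γ K ≤ ν)
    (hKK' : spNorm (K - K') ≤ 1 / (8 * Real.sqrt (ν / ℓ₀) ^ 3 * ψ * φ)) :
    inS A B C γ K' ∧
      |Jcost A B C Q R γ K - Jcost A B C Q R γ K'| ≤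
        16 * Real.sqrt (ν / ℓ₀) ^ 9 * ℓ₁ * ψ * φ * spNorm (K - K') := by
  obtain ⟨hγ0, hγ1⟩ := hγ
  set k := Real.sqrt (ν / ℓ₀) with hkdef
  have hk2 : k ^ 2 = ν / ℓ₀ := Real.sq_sqrt (by positivity)
  have hk0 : 0 < k := Real.sqrt_pos.2 (by positivity)
  have hstable := (inS_iff_spectrum hn A B C hγ0 K).1 hK
  have hsum := summable_norm_pow_of_spectrum hstable
  obtain ⟨S, hS, hSM⟩ := exists_gramian hsum
  have hJ := Jcost_eq_trace A B C Q R hγ0.le K hsum hSM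
  have hR : R.PosSemidef := by
    simpa using hRlb.add (PosSemidef.one.smul hℓ₀.le)
  have hKR : ((K * C)ᵀ * R * (K * C)).PosSemidef := by
    simpa using hR.congr_transpose (K * C)ᵀ
  have hQ : Q.PosSemidef := by
    simpa using hQlb.add (PosSemidef.one.smul hℓ₀.le)
  have hW := hQ.add hKR
  have htr : S.trace ≤ k ^ 2 := by
    have h := posSemidef_trace_mul_nonneg (hQlb.add hKR) hS
    rw [sub_add_eq_add_sub, Matrix.sub_mul, trace_sub, ← hJ, Matrix.smul_mul, trace_smul,
      Matrix.one_mul, smul_eq_mul] at h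
    rw [hk2, le_div_iff₀ hℓ₀]
    linarith
  have hk1 : 1 ≤ k := by
    have h := (hS.congr_transpose (Real.sqrt γ • Acl A B C K)).trace_nonneg
    have h1 := congrArg trace hSM
    rw [trace_add, trace_one, Fintype.card_fin] at h1
    have hn' : (1 : ℝ) ≤ n := by exact_mod_cast hn
    nlinarith
  rcases eq_or_lt_of_le (spNorm_nonneg_s4 (K - K')) with h0 | h0
  · obtain rfl : K = K' := sub_eq_zero.1 (eq_zero_of_spNorm_eq_zero h0.symm)
    exact ⟨hK, by rw [← h0]; simp⟩
  set d := ψ * φ * spNorm (K - K') with hd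
  have hdpos : 0 < d := by positivity
  have hdk : d * k ^ 3 ≤ 1 / 8 := by
    rw [le_div_iff₀ (by positivity)] at hKK'
    rw [hd]
    nlinarith
  have hY := norm_gain_perturbation_le hψ (zero_le_one.trans hφ) hC K K'
  have hΔ := norm_closedLoop_perturbation_le hγ1 hB hC K K'
  rw [← hd] at hY hΔ
  obtain ⟨hE1, hE2⟩ := lyapunov_perturbation hdpos hS hSM htr hΔ
  have hM' : Real.sqrt γ • Acl A B C K + Real.sqrt γ • (B * (K - K') * C) =
      Real.sqrt γ • Acl A B C K' := by
    rw [← smul_add, Acl, Acl, Matrix.mul_sub, Matrix.sub_mul]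
    congr 1
    abel
  rw [hM'] at hE1 hE2
  have hdk2 : d * k ^ 2 ≤ 1 / 8 := by
    refine le_trans ?_ hdk
    gcongr
    norm_num
  have hd8 : d ≤ 1 / 8 := by nlinarith [one_le_pow₀ hk1 (n := 2)]
  have he : d * (2 + d) * k ^ 2 ≤ 1 / 2 := by nlinarith
  have hstable' : ∀ μ ∈ spectrum ℂ ((Real.sqrt γ • Acl A B C K').map (algebraMap ℝ ℂ)),
      ‖μ‖ < 1 := by
    refine norm_lt_one_of_lyapunov_s4 hS one_half_pos ?_
    convert hE1.add (PosSemidef.one.smul (sub_nonneg.2 he)) using 1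
    module
  refine ⟨(inS_iff_spectrum hn A B C hγ0 K').2 hstable', ?_⟩
  have hsum' := summable_norm_pow_of_spectrum hstable'
  obtain ⟨S', hS', hSM'⟩ := exists_gramian hsum'
  have hJ' := Jcost_eq_trace A B C Q R hγ0.le K' hsum' hSM'
  obtain ⟨hcmp, hdiff⟩ := lyapunov_comparison (tendsto_pow_zero_of_summable hsum')
    (by positivity) he hS.isSymm hS'.isSymm hSM' hW hE1 hE2
  obtain ⟨hZ1, hZ2⟩ := stageCost_perturbation (X := K * C) hdpos (hℓ₀.le.trans hℓ₀₁) hR hRub hY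
  rw [← Matrix.add_mul, add_sub_cancel] at hZ1 hZ2
  have hz1 := posSemidef_trace_mul_nonneg hZ1 hS'
  have hz2 := posSemidef_trace_mul_nonneg hZ2 hS'
  have hwS := posSemidef_trace_mul_nonneg hKR hcmp
  have hqS := posSemidef_trace_mul_nonneg hQ hS
  have htr' := hcmp.trace_nonneg
  rw [← hJ] at hdiff
  simp only [Matrix.add_mul, Matrix.sub_mul, Matrix.mul_sub, Matrix.smul_mul, Matrix.mul_smul,
    Matrix.one_mul, trace_add, trace_sub, trace_smul, smul_eq_mul]
    at hz1 hz2 hwS htr' hdiff hJ hJ'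
  have hν' : ν = ℓ₀ * k ^ 2 := by rw [hk2]; field_simp
  have hstage : d * (((K * C)ᵀ * R * (K * C)) * S').trace + (d + d ^ 2) * ℓ₁ * S'.trace ≤
      d * (2 * ν) + (d + d ^ 2) * ℓ₁ * (2 * k ^ 2) := by
    have : 0 ≤ ℓ₁ := hℓ₀.le.trans hℓ₀₁
    gcongr <;> linarith
  have htotal : |Jcost A B C Q R γ K - Jcost A B C Q R γ K'| ≤
      2 * (d * (2 + d) * k ^ 2) * ν + (d * (2 * ν) + (d + d ^ 2) * ℓ₁ * (2 * k ^ 2)) := by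
    have hν2 : 2 * (d * (2 + d) * k ^ 2) * Jcost A B C Q R γ K ≤
        2 * (d * (2 + d) * k ^ 2) * ν := by gcongr
    have hb := abs_le.1 (hdiff.trans hν2)
    rw [abs_le]
    constructor <;> linarith [hb.1, hb.2]
  refine htotal.trans ?_
  have hℓ₁ : 0 < ℓ₁ := hℓ₀.trans_le hℓ₀₁
  calc _ ≤ 2 * (d * (2 + 1) * k ^ 2) * (ℓ₁ * k ^ 2) +
        (d * (2 * (ℓ₁ * k ^ 2)) + (d + d * 1) * ℓ₁ * (2 * k ^ 2)) := by
        rw [hν', pow_two d]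
        gcongr <;> linarith
    _ = d * ℓ₁ * (6 * k ^ 4 + 6 * k ^ 2) := by ring
    _ ≤ d * ℓ₁ * (6 * k ^ 9 + 6 * k ^ 9) := by
        gcongr <;> first | exact hk1 | norm_num
    _ ≤ d * ℓ₁ * (16 * k ^ 9) := by
        gcongr
        linarith [pow_pos hk0 9]
    _ = _ := by rw [hd]; ring
end
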